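/- For any quantum channel N: A→B and α ∈ [1/2,1)∪(1,∞), the α-Tsallis channel entropy satisfies S̃^T_α(N) = inf over pure states ψ_AR, with reference system R of dimension |R| = |A|, of T̃↓_α(B|R)_{(N⊗I_R)(ψ)}. -/

import Mathlib

open scoped Kronecker ComplexOrder

noncomputable section

namespace QIT

variable {n : Type*} [Fintype n] [DecidableEq n]

/-- Real trace of a complex matrix. -/
def rtr (A : Matrix n n ℂ) : ℝ := (Matrix.trace A).re

/-- Apply a real function to a hermitian matrix via spectral decomposition
(junk value `0` for non-hermitian input). -/
def mfun (f : ℝ → ℝ) (A : Matrix n n ℂ) : Matrix n n ℂ :=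
  if hA : A.IsHermitian then
    (Matrix.IsHermitian.eigenvectorUnitary hA : Matrix n n ℂ) *
      Matrix.diagonal (fun i => ((f (hA.eigenvalues i) : ℝ) : ℂ)) *
      (star (Matrix.IsHermitian.eigenvectorUnitary hA : Matrix n n ℂ))
  else 0

/-- Real power of a positive semidefinite matrix (with the conventions
`0 ^ p = 0` for `p ≠ 0`, i.e. powers are taken on the support). -/
def mpow (A : Matrix n n ℂ) (p : ℝ) : Matrix n n ℂ := mfun (fun x => x ^ p) A

/-- Matrix base-2 logarithm (on the support). -/
def mlog (A : Matrix n n ℂ) : Matrix n n ℂ := mfun (Real.logb 2) A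

/-- A quantum state: positive semidefinite with unit trace. -/
def IsState (ρ : Matrix n n ℂ) : Prop := ρ.PosSemidef ∧ Matrix.trace ρ = 1

/-- A pure state: a state of rank one. -/
def IsPureState (ρ : Matrix n n ℂ) : Prop := IsState ρ ∧ ρ.rank = 1

/-- The support (range) ordering: `supp ρ ⊆ supp σ`, expressed as
`ker σ ≤ ker ρ`. -/
def SuppLE (ρ σ : Matrix n n ℂ) : Prop := ∀ v : n → ℂ, σ.mulVec v = 0 → ρ.mulVec v = 0

/-- Trace norm ‖X‖₁ = Tr √(X† X). -/
def traceNorm (X : Matrix n n ℂ) : ℝ := rtr (mpow (X.conjTranspose * X) (2⁻¹ : ℝ))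

/-- von Neumann entropy (base 2). -/
def vnEnt (ρ : Matrix n n ℂ) : ℝ := - rtr (ρ * mlog ρ)

/-- Umegaki relative entropy (base 2), real-valued on its finiteness domain. -/
def relEnt (ρ σ : Matrix n n ℂ) : ℝ := rtr (ρ * mlog ρ) - rtr (ρ * mlog σ)

/-- The sandwiched trace functional Tr{(σ^((1-α)/(2α)) ρ σ^((1-α)/(2α)))^α}. -/
def sandTr (α : ℝ) (ρ σ : Matrix n n ℂ) : ℝ :=
  rtr (mpow (mpow σ ((1 - α) / (2 * α)) * ρ * mpow σ ((1 - α) / (2 * α))) α)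

/-- Sandwiched Rényi relative entropy (base 2). -/
def sandRenyi (α : ℝ) (ρ σ : Matrix n n ℂ) : ℝ := (α - 1)⁻¹ * Real.logb 2 (sandTr α ρ σ)

/-- Sandwiched Tsallis relative entropy. -/
def sandTsallis (α : ℝ) (ρ σ : Matrix n n ℂ) : ℝ := (α - 1)⁻¹ * (sandTr α ρ σ - 1)

/-- (Non-sandwiched) Tsallis relative entropy. -/
def tsallisRel (α : ℝ) (ρ σ : Matrix n n ℂ) : ℝ :=
  (α - 1)⁻¹ * (rtr (mpow ρ α * mpow σ (1 - α)) - 1)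

/-- Tsallis entropy of a state. -/
def tsallisEnt (α : ℝ) (ρ : Matrix n n ℂ) : ℝ := (1 - α)⁻¹ * (rtr (mpow ρ α) - 1)

variable {a b c r : Type*} [Fintype a] [DecidableEq a] [Fintype b] [DecidableEq b]
  [Fintype c] [DecidableEq c] [Fintype r] [DecidableEq r]

/-- Partial trace over the first tensor factor. -/
def ptraceA (ρ : Matrix (a × b) (a × b) ℂ) : Matrix b b ℂ :=
  Matrix.of fun i j => ∑ k : a, ρ (k, i) (k, j)

/-- Partial trace over the second tensor factor. -/
def ptraceB (ρ : Matrix (a × b) (a × b) ℂ) : Matrix a a ℂ :=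
  Matrix.of fun i j => ∑ k : b, ρ (i, k) (j, k)

/-- Conditional sandwiched Rényi entropy H̃↓_α(A|B). -/
def condRenyiDown (α : ℝ) (ρ : Matrix (a × b) (a × b) ℂ) : ℝ :=
  - sandRenyi α ρ ((1 : Matrix a a ℂ) ⊗ₖ ptraceA ρ)

/-- Conditional sandwiched Tsallis entropy T̃↓_α(A|B). -/
def condTsallisSandDown (α : ℝ) (ρ : Matrix (a × b) (a × b) ℂ) : ℝ :=
  - sandTsallis α ρ ((1 : Matrix a a ℂ) ⊗ₖ ptraceA ρ)

/-- Optimized conditional sandwiched Tsallis entropy T̃↑_α(A|B). -/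
def condTsallisSandUp (α : ℝ) (ρ : Matrix (a × b) (a × b) ℂ) : ℝ :=
  - ⨅ σ : {σ : Matrix b b ℂ // IsState σ}, sandTsallis α ρ ((1 : Matrix a a ℂ) ⊗ₖ σ.1)

/-- Conditional (non-sandwiched) Tsallis entropy T↓_α(A|B). -/
def condTsallisDown (α : ℝ) (ρ : Matrix (a × b) (a × b) ℂ) : ℝ :=
  - tsallisRel α ρ ((1 : Matrix a a ℂ) ⊗ₖ ptraceA ρ)

/-- Conditional von Neumann entropy H(A|B) = S(AB) - S(B). -/
def condvnEnt (ρ : Matrix (a × b) (a × b) ℂ) : ℝ := vnEnt ρ - vnEnt (ptraceA ρ)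

/-- The extension `N ⊗ I_r` of a linear map on matrices. -/
def tensorId (N : Matrix a a ℂ →ₗ[ℂ] Matrix b b ℂ) (r : Type*) [Fintype r] [DecidableEq r] :
    Matrix (a × r) (a × r) ℂ →ₗ[ℂ] Matrix (b × r) (b × r) ℂ where
  toFun ρ := Matrix.of fun p q => N (Matrix.of fun x y => ρ (x, p.2) (y, q.2)) p.1 q.1
  map_add' ρ₁ ρ₂ := by
    ext p q
    have h : (Matrix.of fun x y => (ρ₁ + ρ₂) (x, p.2) (y, q.2))
        = (Matrix.of fun x y => ρ₁ (x, p.2) (y, q.2))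
          + (Matrix.of fun x y => ρ₂ (x, p.2) (y, q.2)) := by
      ext x y; simp
    show N (Matrix.of fun x y => (ρ₁ + ρ₂) (x, p.2) (y, q.2)) p.1 q.1 = _
    rw [h, map_add]; rfl
  map_smul' z ρ := by
    ext p q
    have h : (Matrix.of fun x y => (z • ρ) (x, p.2) (y, q.2))
        = z • (Matrix.of fun x y => ρ (x, p.2) (y, q.2)) := by
      ext x y; simp
    show N (Matrix.of fun x y => (z • ρ) (x, p.2) (y, q.2)) p.1 q.1 = _
    rw [h, map_smul]; rfl

/-- The extension `I_r ⊗ M` of a linear map on matrices. -/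
def idTensor (M : Matrix a a ℂ →ₗ[ℂ] Matrix b b ℂ) (r : Type*) [Fintype r] [DecidableEq r] :
    Matrix (r × a) (r × a) ℂ →ₗ[ℂ] Matrix (r × b) (r × b) ℂ where
  toFun ρ := Matrix.of fun p q => M (Matrix.of fun x y => ρ (p.1, x) (q.1, y)) p.2 q.2
  map_add' ρ₁ ρ₂ := by
    ext p q
    have h : (Matrix.of fun x y => (ρ₁ + ρ₂) (p.1, x) (q.1, y))
        = (Matrix.of fun x y => ρ₁ (p.1, x) (q.1, y))
          + (Matrix.of fun x y => ρ₂ (p.1, x) (q.1, y)) := by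
      ext x y; simp
    show M (Matrix.of fun x y => (ρ₁ + ρ₂) (p.1, x) (q.1, y)) p.2 q.2 = _
    rw [h, map_add]; rfl
  map_smul' z ρ := by
    ext p q
    have h : (Matrix.of fun x y => (z • ρ) (p.1, x) (q.1, y))
        = z • (Matrix.of fun x y => ρ (p.1, x) (q.1, y)) := by
      ext x y; simp
    show M (Matrix.of fun x y => (z • ρ) (p.1, x) (q.1, y)) p.2 q.2 = _
    rw [h, map_smul]; rfl

/-- A quantum channel: trace preserving and completely positive. -/
def IsChannel (N : Matrix a a ℂ →ₗ[ℂ] Matrix b b ℂ) : Prop :=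
  (∀ ρ : Matrix a a ℂ, Matrix.trace (N ρ) = Matrix.trace ρ) ∧
  ∀ (k : ℕ) (ρ : Matrix (a × Fin k) (a × Fin k) ℂ), ρ.PosSemidef →
    (tensorId N (Fin k) ρ).PosSemidef

/-- The maximally mixed state on system `b`. -/
def maxMixed (b : Type*) [Fintype b] [DecidableEq b] : Matrix b b ℂ :=
  ((Fintype.card b : ℂ))⁻¹ • (1 : Matrix b b ℂ)

/-- The completely randomizing (depolarizing) channel. -/
def randomizing (a b : Type*) [Fintype a] [DecidableEq a] [Fintype b] [DecidableEq b] :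
    Matrix a a ℂ →ₗ[ℂ] Matrix b b ℂ :=
  (Matrix.traceLinearMap a ℂ ℂ).smulRight (maxMixed b)

/-- The replacer channel `ρ ↦ Tr(ρ) σ`. -/
def replacer (a : Type*) [Fintype a] [DecidableEq a] (σ : Matrix b b ℂ) :
    Matrix a a ℂ →ₗ[ℂ] Matrix b b ℂ :=
  (Matrix.traceLinearMap a ℂ ℂ).smulRight σ

/-- Channel (Umegaki) relative entropy: supremum over all finite reference systems. -/
def chRelEnt (N M : Matrix a a ℂ →ₗ[ℂ] Matrix b b ℂ) : ℝ :=
  ⨆ p : Σ k : ℕ, {ρ : Matrix (a × Fin k) (a × Fin k) ℂ // IsState ρ},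
    relEnt (tensorId N (Fin p.1) p.2.1) (tensorId M (Fin p.1) p.2.1)

/-- Channel sandwiched Rényi relative entropy. -/
def chSandRenyi (α : ℝ) (N M : Matrix a a ℂ →ₗ[ℂ] Matrix b b ℂ) : ℝ :=
  ⨆ p : Σ k : ℕ, {ρ : Matrix (a × Fin k) (a × Fin k) ℂ // IsState ρ},
    sandRenyi α (tensorId N (Fin p.1) p.2.1) (tensorId M (Fin p.1) p.2.1)

/-- Channel sandwiched Tsallis relative entropy. -/
def chSandTsallis (α : ℝ) (N M : Matrix a a ℂ →ₗ[ℂ] Matrix b b ℂ) : ℝ :=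
  ⨆ p : Σ k : ℕ, {ρ : Matrix (a × Fin k) (a × Fin k) ℂ // IsState ρ},
    sandTsallis α (tensorId N (Fin p.1) p.2.1) (tensorId M (Fin p.1) p.2.1)

/-- Diamond distance between two maps. -/
def diamondDist (N M : Matrix a a ℂ →ₗ[ℂ] Matrix b b ℂ) : ℝ :=
  ⨆ p : Σ k : ℕ, {ρ : Matrix (a × Fin k) (a × Fin k) ℂ // IsState ρ},
    traceNorm (tensorId N (Fin p.1) p.2.1 - tensorId M (Fin p.1) p.2.1)

/-- Entropy of a quantum channel. -/
def chEnt (N : Matrix a a ℂ →ₗ[ℂ] Matrix b b ℂ) : ℝ :=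
  Real.logb 2 (Fintype.card b) - chRelEnt N (randomizing a b)

/-- α-Rényi entropy of a quantum channel. -/
def chRenyiEnt (α : ℝ) (N : Matrix a a ℂ →ₗ[ℂ] Matrix b b ℂ) : ℝ :=
  Real.logb 2 (Fintype.card b) - chSandRenyi α N (randomizing a b)

/-- α-Tsallis entropy of a quantum channel. -/
def chTsallisEnt (α : ℝ) (N : Matrix a a ℂ →ₗ[ℂ] Matrix b b ℂ) : ℝ :=
  ((Fintype.card b : ℝ) ^ (1 - α) - 1) / (1 - α)
    - (Fintype.card b : ℝ) ^ (1 - α) * chSandTsallis α N (randomizing a b)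

set_option linter.unusedSectionVars false

section SpectralCalculus

variable {m p : Type*} [Fintype m] [DecidableEq m] [Fintype p] [DecidableEq p]

lemma mfun_eq {A : Matrix n n ℂ} (hA : A.IsHermitian) (f : ℝ → ℝ) :
    mfun f A = (hA.eigenvectorUnitary : Matrix n n ℂ) *
      Matrix.diagonal (fun i => ((f (hA.eigenvalues i) : ℝ) : ℂ)) *
      (star (hA.eigenvectorUnitary : Matrix n n ℂ)) := dif_pos hA

lemma star_eigenvectorUnitary_mul {A : Matrix n n ℂ} (hA : A.IsHermitian) :
    star (hA.eigenvectorUnitary : Matrix n n ℂ) * (hA.eigenvectorUnitary : Matrix n n ℂ) = 1 :=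
  Unitary.coe_star_mul_self _

lemma eigenvectorUnitary_mul_star {A : Matrix n n ℂ} (hA : A.IsHermitian) :
    (hA.eigenvectorUnitary : Matrix n n ℂ) * star (hA.eigenvectorUnitary : Matrix n n ℂ) = 1 :=
  Unitary.coe_mul_star_self _

lemma mfun_id {A : Matrix n n ℂ} (hA : A.IsHermitian) : mfun (fun x => x) A = A := by
  conv_rhs => rw [hA.spectral_theorem]
  rw [mfun_eq hA, Unitary.conjStarAlgAut_apply]
  rfl

lemma mfun_one {A : Matrix n n ℂ} (hA : A.IsHermitian) : mfun (fun _ => 1) A = 1 := by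
  rw [mfun_eq hA]
  simp

lemma mfun_congr {A : Matrix n n ℂ} (hA : A.IsHermitian) {f g : ℝ → ℝ}
    (h : ∀ i, f (hA.eigenvalues i) = g (hA.eigenvalues i)) : mfun f A = mfun g A := by
  rw [mfun_eq hA, mfun_eq hA]
  simp only [h]

lemma mfun_congr_nonneg {A : Matrix n n ℂ} (hA : A.PosSemidef) {f g : ℝ → ℝ}
    (h : ∀ x, 0 ≤ x → f x = g x) : mfun f A = mfun g A :=
  mfun_congr hA.isHermitian fun i => h _ (hA.eigenvalues_nonneg i)

lemma mfun_isHermitian (f : ℝ → ℝ) (A : Matrix n n ℂ) : (mfun f A).IsHermitian := by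
  by_cases hA : A.IsHermitian
  · rw [mfun_eq hA]
    unfold Matrix.IsHermitian
    simp only [Matrix.star_eq_conjTranspose, Matrix.conjTranspose_mul,
      Matrix.conjTranspose_conjTranspose, Matrix.diagonal_conjTranspose, Matrix.mul_assoc]
    congr 3
    ext i
    simp
  · simp [mfun, hA]

/-- Functional calculus intertwines whatever the arguments intertwine. -/
lemma mfun_mul_intertwine {A : Matrix n n ℂ} {B : Matrix m m ℂ} (hA : A.IsHermitian)
    (hB : B.IsHermitian) {X : Matrix n m ℂ} (h : A * X = X * B) (f : ℝ → ℝ) :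
    mfun f A * X = X * mfun f B := by
  set U := (hA.eigenvectorUnitary : Matrix n n ℂ) with hU
  set V := (hB.eigenvectorUnitary : Matrix m m ℂ) with hV
  have hUU : U * star U = 1 := eigenvectorUnitary_mul_star hA
  have hUU' : star U * U = 1 := star_eigenvectorUnitary_mul hA
  have hVV : V * star V = 1 := eigenvectorUnitary_mul_star hB
  have hVV' : star V * V = 1 := star_eigenvectorUnitary_mul hB
  have key : ∀ g : ℝ → ℝ, mfun g A * X = X * mfun g B ↔
      Matrix.diagonal (fun i => ((g (hA.eigenvalues i) : ℝ) : ℂ)) * (star U * X * V)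
        = (star U * X * V) * Matrix.diagonal (fun i => ((g (hB.eigenvalues i) : ℝ) : ℂ)) := by
    intro g
    rw [mfun_eq hA, mfun_eq hB, ← hU, ← hV]
    constructor
    · intro h
      have := congrArg (fun M => star U * M * V) h
      simp only [Matrix.mul_assoc] at this
      rw [hVV', ← Matrix.mul_assoc (star U) U, hUU'] at this
      simpa [Matrix.mul_assoc] using this
    · intro h
      have := congrArg (fun M => U * M * star V) h
      simp only [Matrix.mul_assoc] at this
      rw [hVV, ← Matrix.mul_assoc U (star U), hUU] at this
      simpa [Matrix.mul_assoc] using this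
  have h1 := (key (fun x => x)).1 (by rw [mfun_id hA, mfun_id hB, h])
  refine (key f).2 ?_
  ext i j
  have h2 := congrFun (congrFun h1 i) j
  rw [Matrix.diagonal_mul, Matrix.mul_diagonal] at h2 ⊢
  by_cases hx : (star U * X * V) i j = 0
  · simp [hx]
  · rw [mul_comm ((star U * X * V) i j)] at h2 ⊢
    have h3 := mul_right_cancel₀ hx h2
    rw [Complex.ofReal_inj] at h3
    simp only [h3]

lemma mfun_conj_unitary {d : n → ℝ} {W : Matrix n n ℂ} (hW : star W * W = 1) (f : ℝ → ℝ) :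
    mfun f (W * Matrix.diagonal (fun i => ((d i : ℝ) : ℂ)) * star W)
      = W * Matrix.diagonal (fun i => ((f (d i) : ℝ) : ℂ)) * star W := by
  have hW' : W * star W = 1 := mul_eq_one_comm.mp hW
  have hD : (Matrix.diagonal (fun i => ((d i : ℝ) : ℂ))).IsHermitian := by
    unfold Matrix.IsHermitian
    rw [Matrix.diagonal_conjTranspose]
    congr 1
    ext i
    simp
  have hA : (W * Matrix.diagonal (fun i => ((d i : ℝ) : ℂ)) * star W).IsHermitian := by
    unfold Matrix.IsHermitian
    rw [Matrix.star_eq_conjTranspose, Matrix.conjTranspose_mul, Matrix.conjTranspose_mul, hD.eq,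
      Matrix.conjTranspose_conjTranspose, Matrix.mul_assoc]
  have hdiag : mfun f (Matrix.diagonal (fun i => ((d i : ℝ) : ℂ)))
      = Matrix.diagonal (fun i => ((f (d i) : ℝ) : ℂ)) := by
    set V := (hD.eigenvectorUnitary : Matrix n n ℂ) with hV
    have hVV : V * star V = 1 := eigenvectorUnitary_mul_star hD
    have hVV' : star V * V = 1 := star_eigenvectorUnitary_mul hD
    have h1 : Matrix.diagonal (fun i => ((d i : ℝ) : ℂ)) * V
        = V * Matrix.diagonal (fun i => ((hD.eigenvalues i : ℝ) : ℂ)) := by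
      conv_lhs => rw [← mfun_id hD]
      rw [mfun_eq hD, ← hV, Matrix.mul_assoc, hVV', Matrix.mul_one]
    have h2 : Matrix.diagonal (fun i => ((f (d i) : ℝ) : ℂ)) * V
        = V * Matrix.diagonal (fun i => ((f (hD.eigenvalues i) : ℝ) : ℂ)) := by
      ext i j
      have h3 := congrFun (congrFun h1 i) j
      rw [Matrix.diagonal_mul, Matrix.mul_diagonal] at h3 ⊢
      by_cases hx : V i j = 0
      · simp [hx]
      · rw [mul_comm (V i j)] at h3 ⊢
        have h4 := mul_right_cancel₀ hx h3
        rw [Complex.ofReal_inj] at h4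
        simp only [h4]
    rw [mfun_eq hD, ← hV, ← h2, Matrix.mul_assoc, hVV, Matrix.mul_one]
  have := mfun_mul_intertwine hA hD (X := W) (by rw [Matrix.mul_assoc, hW, Matrix.mul_one]) f
  rw [hdiag] at this
  rw [← this, Matrix.mul_assoc _ W, hW', Matrix.mul_one]

lemma mfun_mfun {A : Matrix n n ℂ} (hA : A.IsHermitian) (f g : ℝ → ℝ) :
    mfun f (mfun g A) = mfun (fun x => f (g x)) A := by
  rw [mfun_eq hA g, mfun_eq hA,
    mfun_conj_unitary (d := fun i => g (hA.eigenvalues i)) (star_eigenvectorUnitary_mul hA)]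

lemma mfun_mul_mfun {A : Matrix n n ℂ} (hA : A.IsHermitian) (f g : ℝ → ℝ) :
    mfun f A * mfun g A = mfun (fun x => f x * g x) A := by
  rw [mfun_eq hA f, mfun_eq hA g, mfun_eq hA]
  simp only [Matrix.mul_assoc]
  rw [← Matrix.mul_assoc (star _) (hA.eigenvectorUnitary : Matrix n n ℂ),
    star_eigenvectorUnitary_mul hA, Matrix.one_mul, ← Matrix.mul_assoc (Matrix.diagonal _),
    Matrix.diagonal_mul_diagonal]
  simp

lemma smul_mfun {A : Matrix n n ℂ} (hA : A.IsHermitian) (c : ℝ) (f : ℝ → ℝ) :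
    (c : ℂ) • mfun f A = mfun (fun x => c * f x) A := by
  rw [mfun_eq hA, mfun_eq hA, ← Matrix.smul_mul, ← Matrix.mul_smul, ← Matrix.diagonal_smul]
  congr 3
  ext i
  simp

lemma rtr_mfun {A : Matrix n n ℂ} (hA : A.IsHermitian) (f : ℝ → ℝ) :
    rtr (mfun f A) = ∑ i, f (hA.eigenvalues i) := by
  rw [mfun_eq hA, rtr, Matrix.trace_mul_cycle, star_eigenvectorUnitary_mul hA, Matrix.one_mul,
    Matrix.trace_diagonal, Complex.re_sum]
  simp

lemma mfun_posSemidef {A : Matrix n n ℂ} (hA : A.IsHermitian) {f : ℝ → ℝ}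
    (hf : ∀ i, 0 ≤ f (hA.eigenvalues i)) : (mfun f A).PosSemidef := by
  rw [mfun_eq hA]
  refine Matrix.PosSemidef.mul_mul_conjTranspose_same ?_ _
  rw [Matrix.posSemidef_diagonal_iff]
  intro i
  exact_mod_cast hf i

lemma mpow_posSemidef {A : Matrix n n ℂ} (hA : A.PosSemidef) (s : ℝ) : (mpow A s).PosSemidef :=
  mfun_posSemidef hA.isHermitian fun i => Real.rpow_nonneg (hA.eigenvalues_nonneg i) s

lemma mfun_posDef {A : Matrix n n ℂ} (hA : A.IsHermitian) {f : ℝ → ℝ}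
    (hf : ∀ i, 0 < f (hA.eigenvalues i)) : (mfun f A).PosDef := by
  rw [mfun_eq hA]
  refine (Matrix.IsUnit.posDef_star_right_conjugate_iff ?_).2 ?_
  · exact IsUnit.of_mul_eq_one _ (eigenvectorUnitary_mul_star hA)
  rw [Matrix.posDef_diagonal_iff]
  intro i
  exact_mod_cast hf i

lemma mpow_smul {A : Matrix n n ℂ} (hA : A.PosSemidef) {c : ℝ} (hc : 0 ≤ c) (s : ℝ) :
    mpow ((c : ℂ) • A) s = ((c ^ s : ℝ) : ℂ) • mpow A s := by
  have h := smul_mfun hA.isHermitian c (fun x => x)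
  rw [mfun_id hA.isHermitian] at h
  rw [h, mpow, mfun_mfun hA.isHermitian, mpow, smul_mfun hA.isHermitian]
  exact mfun_congr_nonneg hA fun x hx => Real.mul_rpow hc hx

lemma rtr_mul_comm (X : Matrix n m ℂ) (Y : Matrix m n ℂ) : rtr (X * Y) = rtr (Y * X) := by
  rw [rtr, rtr, Matrix.trace_mul_comm]

lemma rtr_smul (c : ℝ) (X : Matrix n n ℂ) : rtr ((c : ℂ) • X) = c * rtr X := by
  simp [rtr, Matrix.trace_smul]

lemma rtr_nonneg {A : Matrix n n ℂ} (hA : A.PosSemidef) : 0 ≤ rtr A := by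
  rw [← mfun_id hA.isHermitian, rtr_mfun hA.isHermitian]
  exact Finset.sum_nonneg fun i _ => hA.eigenvalues_nonneg i

/-- The trace of a power of `X * Xᴴ` equals that of `Xᴴ * X`. -/
lemma rtr_mpow_mul_conjTranspose (X : Matrix n m ℂ) {s : ℝ} (hs : s ≠ 0) :
    rtr (mpow (X * X.conjTranspose) s) = rtr (mpow (X.conjTranspose * X) s) := by
  have h1 : (X * X.conjTranspose).PosSemidef := Matrix.posSemidef_self_mul_conjTranspose X
  have h2 : (X.conjTranspose * X).PosSemidef := Matrix.posSemidef_conjTranspose_mul_self X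
  have hpow : ∀ x : ℝ, 0 ≤ x → x ^ s = x ^ (s - 1) * x := by
    intro x hx
    rcases hx.eq_or_lt with rfl | hx
    · simp [Real.zero_rpow hs]
    · rw [← Real.rpow_add_one hx.ne', sub_add_cancel]
  have e1 : mpow (X * X.conjTranspose) s
      = mfun (fun x => x ^ (s - 1)) (X * X.conjTranspose) * (X * X.conjTranspose) := by
    conv_rhs => rw [← mfun_id h1.isHermitian]
    rw [mfun_mfun h1.isHermitian, mfun_mul_mfun h1.isHermitian]
    exact mfun_congr_nonneg h1 hpow
  have e2 : mpow (X.conjTranspose * X) s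
      = mfun (fun x => x ^ (s - 1)) (X.conjTranspose * X) * (X.conjTranspose * X) := by
    conv_rhs => rw [← mfun_id h2.isHermitian]
    rw [mfun_mfun h2.isHermitian, mfun_mul_mfun h2.isHermitian]
    exact mfun_congr_nonneg h2 hpow
  rw [e1, e2, ← Matrix.mul_assoc, mfun_mul_intertwine h1.isHermitian h2.isHermitian
    (Matrix.mul_assoc _ _ _), Matrix.mul_assoc, rtr_mul_comm, Matrix.mul_assoc]

end SpectralCalculus

section Pinching

variable {m p : Type*} [Fintype m] [DecidableEq m] [Fintype p] [DecidableEq p]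

/-- The double spectral sum `∑ i j, F aᵢ bⱼ |⟨i|X|j⟩|²` over eigenbases of `A` and `B`. -/
def spectralSum (F : ℝ → ℝ → ℝ) {A : Matrix n n ℂ} (hA : A.IsHermitian) {B : Matrix m m ℂ}
    (hB : B.IsHermitian) (X : Matrix n m ℂ) : ℝ :=
  ∑ i, ∑ j, F (hA.eigenvalues i) (hB.eigenvalues j) *
    Complex.normSq ((star (hA.eigenvectorUnitary : Matrix n n ℂ) * X *
      (hB.eigenvectorUnitary : Matrix m m ℂ)) i j)

lemma spectralSum_mul {A : Matrix n n ℂ} (hA : A.IsHermitian) {B : Matrix m m ℂ}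
    (hB : B.IsHermitian) (X : Matrix n m ℂ) (f g : ℝ → ℝ) :
    spectralSum (fun x y => f x * g y) hA hB X
      = rtr (X.conjTranspose * mfun f A * X * mfun g B) := by
  rw [mfun_eq hA, mfun_eq hB, spectralSum]
  set U := (hA.eigenvectorUnitary : Matrix n n ℂ)
  set V := (hB.eigenvectorUnitary : Matrix m m ℂ)
  set D := Matrix.diagonal (fun i => ((f (hA.eigenvalues i) : ℝ) : ℂ))
  set E := Matrix.diagonal (fun i => ((g (hB.eigenvalues i) : ℝ) : ℂ))
  have h : rtr (X.conjTranspose * (U * D * star U) * X * (V * E * star V))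
      = rtr ((star U * X * V).conjTranspose * D * (star U * X * V) * E) := by
    rw [← Matrix.mul_assoc _ (V * E), rtr_mul_comm]
    simp only [Matrix.star_eq_conjTranspose, Matrix.conjTranspose_mul,
      Matrix.conjTranspose_conjTranspose, Matrix.mul_assoc]
  rw [h]
  set x := star U * X * V
  simp only [rtr, Matrix.trace, Matrix.diag, Complex.re_sum]
  rw [Finset.sum_comm]
  refine Finset.sum_congr rfl fun j _ => ?_
  rw [Matrix.mul_diagonal, Matrix.mul_apply, Finset.sum_mul, Complex.re_sum]
  refine Finset.sum_congr rfl fun i _ => ?_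
  rw [Matrix.mul_diagonal, Matrix.conjTranspose_apply]
  have : star (x i j) * ((f (hA.eigenvalues i) : ℝ) : ℂ) * x i j * ((g (hB.eigenvalues j) : ℝ) : ℂ)
      = ((f (hA.eigenvalues i) * g (hB.eigenvalues j) * Complex.normSq (x i j) : ℝ) : ℂ) := by
    push_cast
    rw [Complex.normSq_eq_conj_mul_self, Complex.star_def]
    ring
  rw [this, Complex.ofReal_re]

lemma spectralSum_mono {A : Matrix n n ℂ} (hA : A.IsHermitian) {B : Matrix m m ℂ}
    (hB : B.IsHermitian) (X : Matrix n m ℂ) {F G : ℝ → ℝ → ℝ}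
    (h : ∀ i j, F (hA.eigenvalues i) (hB.eigenvalues j) ≤ G (hA.eigenvalues i) (hB.eigenvalues j)) :
    spectralSum F hA hB X ≤ spectralSum G hA hB X :=
  Finset.sum_le_sum fun i _ => Finset.sum_le_sum fun j _ =>
    mul_le_mul_of_nonneg_right (h i j) (Complex.normSq_nonneg _)

lemma spectralSum_congr {A : Matrix n n ℂ} (hA : A.IsHermitian) {B : Matrix m m ℂ}
    (hB : B.IsHermitian) (X : Matrix n m ℂ) {F G : ℝ → ℝ → ℝ}
    (h : ∀ i j, F (hA.eigenvalues i) (hB.eigenvalues j) = G (hA.eigenvalues i) (hB.eigenvalues j)) :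
    spectralSum F hA hB X = spectralSum G hA hB X := by
  simp only [spectralSum, h]

lemma spectralSum_lincomb {A : Matrix n n ℂ} (hA : A.IsHermitian) {B : Matrix m m ℂ}
    (hB : B.IsHermitian) (X : Matrix n m ℂ) (c d : ℝ) (F G : ℝ → ℝ → ℝ) :
    spectralSum (fun x y => c * F x y + d * G x y) hA hB X
      = c * spectralSum F hA hB X + d * spectralSum G hA hB X := by
  simp only [spectralSum, Finset.mul_sum, ← Finset.sum_add_distrib]
  refine Finset.sum_congr rfl fun i _ => Finset.sum_congr rfl fun j _ => by ring

lemma spectralSum_left {A : Matrix n n ℂ} (hA : A.IsHermitian) {B : Matrix m m ℂ}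
    (hB : B.IsHermitian) (X : Matrix n m ℂ) :
    spectralSum (fun x _ => x) hA hB X = rtr (X.conjTranspose * A * X) := by
  have := spectralSum_mul hA hB X (fun x => x) (fun _ => 1)
  simpa [mfun_id hA, mfun_one hB] using this

lemma spectralSum_right {A : Matrix n n ℂ} (hA : A.IsHermitian) {B : Matrix m m ℂ}
    (hB : B.IsHermitian) (X : Matrix n m ℂ) :
    spectralSum (fun _ y => y) hA hB X = rtr (X.conjTranspose * X * B) := by
  have := spectralSum_mul hA hB X (fun _ => 1) (fun x => x)
  simpa [mfun_one hA, mfun_id hB] using this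

lemma normSq_harmonic_le {x y t : ℝ} (hx : 0 ≤ x) (hy : 0 ≤ y) (ht : 0 < t) (u v : ℂ) :
    t * (x * y / (t * y + x)) * Complex.normSq u
      ≤ x * Complex.normSq (u - v) + t * (y * Complex.normSq v) := by
  have hty : 0 ≤ t * y := by positivity
  rcases (add_nonneg hty hx).eq_or_lt with h | h
  · rw [← h]
    simp only [div_zero, mul_zero, zero_mul]
    have := Complex.normSq_nonneg (u - v)
    have := Complex.normSq_nonneg v
    positivity
  · rw [← mul_div_assoc, div_mul_eq_mul_div, div_le_iff₀ h]
    simp only [Complex.normSq_apply, Complex.sub_re, Complex.sub_im]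
    nlinarith [sq_nonneg ((t * y + x) * v.re - x * u.re), sq_nonneg ((t * y + x) * v.im - x * u.im)]

lemma normSq_harmonic_eq {x y t : ℝ} (hx : 0 ≤ x) (hy : 0 ≤ y) (ht : 0 < t) (u : ℂ) :
    t * (x * y / (t * y + x)) * Complex.normSq u
      = x * Complex.normSq (u - ((x / (t * y + x) : ℝ) : ℂ) * u)
        + t * (y * Complex.normSq (((x / (t * y + x) : ℝ) : ℂ) * u)) := by
  have hty : 0 ≤ t * y := by positivity
  rcases (add_nonneg hty hx).eq_or_lt with h | h
  · have hx0 : x = 0 := by linarith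
    simp [hx0]
  · simp only [Complex.normSq_apply, Complex.sub_re, Complex.sub_im, Complex.re_ofReal_mul,
      Complex.im_ofReal_mul]
    field_simp
    ring

lemma spectralSum_harmonic_le {A : Matrix n n ℂ} (hA : A.PosSemidef) {B : Matrix m m ℂ}
    (hB : B.PosSemidef) (X Y : Matrix n m ℂ) {t : ℝ} (ht : 0 < t) :
    t * spectralSum (fun x y => x * y / (t * y + x)) hA.isHermitian hB.isHermitian X
      ≤ rtr ((X - Y).conjTranspose * A * (X - Y)) + t * rtr (Y.conjTranspose * Y * B) := by
  rw [← spectralSum_left hA.isHermitian hB.isHermitian,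
    ← spectralSum_right hA.isHermitian hB.isHermitian]
  simp only [spectralSum, Finset.mul_sum, ← Finset.sum_add_distrib]
  refine Finset.sum_le_sum fun i _ => Finset.sum_le_sum fun j _ => ?_
  rw [← mul_assoc]
  simpa only [Matrix.mul_sub, Matrix.sub_mul, Matrix.sub_apply] using
    normSq_harmonic_le (hA.eigenvalues_nonneg i) (hB.eigenvalues_nonneg j) ht _ _

lemma exists_spectralSum_harmonic_eq {A : Matrix n n ℂ} (hA : A.PosSemidef) {B : Matrix m m ℂ}
    (hB : B.PosSemidef) (X : Matrix n m ℂ) {t : ℝ} (ht : 0 < t) :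
    ∃ Y : Matrix n m ℂ,
      t * spectralSum (fun x y => x * y / (t * y + x)) hA.isHermitian hB.isHermitian X
        = rtr ((X - Y).conjTranspose * A * (X - Y)) + t * rtr (Y.conjTranspose * Y * B) := by
  set U := (hA.isHermitian.eigenvectorUnitary : Matrix n n ℂ) with hU
  set V := (hB.isHermitian.eigenvectorUnitary : Matrix m m ℂ) with hV
  have hU1 : star U * U = 1 := star_eigenvectorUnitary_mul hA.isHermitian
  have hV1 : star V * V = 1 := star_eigenvectorUnitary_mul hB.isHermitian
  set a := hA.isHermitian.eigenvalues with ha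
  set b := hB.isHermitian.eigenvalues with hb
  let y : Matrix n m ℂ :=
    Matrix.of fun i j => ((a i / (t * b j + a i) : ℝ) : ℂ) * (star U * X * V) i j
  have hy : star U * (U * y * star V) * V = y := by
    simp only [Matrix.mul_assoc]
    rw [hV1, ← Matrix.mul_assoc, hU1, Matrix.one_mul, Matrix.mul_one]
  refine ⟨U * y * star V, ?_⟩
  rw [← spectralSum_left hA.isHermitian hB.isHermitian,
    ← spectralSum_right hA.isHermitian hB.isHermitian]
  simp only [spectralSum, Finset.mul_sum, ← Finset.sum_add_distrib, ← hU, ← hV, ← ha, ← hb,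
    Matrix.mul_sub (star U), Matrix.sub_mul _ _ V, hy, Matrix.sub_apply]
  refine Finset.sum_congr rfl fun i _ => Finset.sum_congr rfl fun j _ => ?_
  rw [← mul_assoc]
  exact normSq_harmonic_eq (hA.eigenvalues_nonneg i) (hB.eigenvalues_nonneg j) ht _

/-- The diagonal block of `T` at index `e` of the second factor. -/
def block (T : Matrix (n × m) (n × m) ℂ) (e : m) : Matrix n n ℂ :=
  T.submatrix (fun i => (i, e)) (fun i => (i, e))

lemma block_posSemidef {T : Matrix (n × m) (n × m) ℂ} (hT : T.PosSemidef) (e : m) :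
    (block T e).PosSemidef := hT.submatrix _

lemma block_posDef {T : Matrix (n × m) (n × m) ℂ} (hT : T.PosDef) (e : m) :
    (block T e).PosDef := hT.submatrix fun i j h => by simpa using h

lemma rtr_mul_blockDiagonal (T : Matrix (n × m) (n × m) ℂ) (D : m → Matrix n n ℂ) :
    rtr (T * Matrix.blockDiagonal D) = ∑ e, rtr (block T e * D e) := by
  simp only [rtr, Matrix.trace, Matrix.diag, Matrix.mul_apply, Fintype.sum_prod_type,
    Matrix.blockDiagonal_apply, block, Matrix.submatrix_apply, Complex.re_sum]
  rw [Finset.sum_comm]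
  refine Finset.sum_congr rfl fun e _ => Finset.sum_congr rfl fun i _ =>
    Finset.sum_congr rfl fun j _ => ?_
  rw [← Complex.re_sum]
  simp

lemma rtr_sandwich_blockDiagonal (T : Matrix (n × m) (n × m) ℂ) (D : m → Matrix n n ℂ) :
    rtr ((Matrix.blockDiagonal D).conjTranspose * T * Matrix.blockDiagonal D)
      = ∑ e, rtr ((D e).conjTranspose * block T e * D e) := by
  rw [Matrix.mul_assoc, rtr_mul_comm, Matrix.mul_assoc, Matrix.blockDiagonal_conjTranspose,
    ← Matrix.blockDiagonal_mul, rtr_mul_blockDiagonal]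
  refine Finset.sum_congr rfl fun e _ => ?_
  rw [Matrix.mul_assoc, rtr_mul_comm (D e).conjTranspose, Matrix.mul_assoc]

lemma rtr_square_blockDiagonal (T : Matrix (n × m) (n × m) ℂ) (D : m → Matrix n n ℂ) :
    rtr ((Matrix.blockDiagonal D).conjTranspose * Matrix.blockDiagonal D * T)
      = ∑ e, rtr ((D e).conjTranspose * D e * block T e) := by
  rw [rtr_mul_comm, Matrix.blockDiagonal_conjTranspose, ← Matrix.blockDiagonal_mul,
    rtr_mul_blockDiagonal]
  exact Finset.sum_congr rfl fun e _ => rtr_mul_comm _ _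

lemma spectralSum_harmonic_pinch {T Z : Matrix (n × m) (n × m) ℂ} (hT : T.PosSemidef)
    (hZ : Z.PosSemidef) (X : Matrix n n ℂ) {t : ℝ} (ht : 0 < t) :
    spectralSum (fun x y => x * y / (t * y + x)) hT.isHermitian hZ.isHermitian
        (Matrix.blockDiagonal fun _ : m => X)
      ≤ ∑ e, spectralSum (fun x y => x * y / (t * y + x)) (block_posSemidef hT e).isHermitian
          (block_posSemidef hZ e).isHermitian X := by
  choose Y hY using fun e =>
    exists_spectralSum_harmonic_eq (block_posSemidef hT e) (block_posSemidef hZ e) X ht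
  refine le_of_mul_le_mul_left ?_ ht
  rw [Finset.mul_sum, Finset.sum_congr rfl fun e _ => hY e]
  refine (spectralSum_harmonic_le hT hZ _ (Matrix.blockDiagonal Y) ht).trans_eq ?_
  rw [← Matrix.blockDiagonal_sub, rtr_sandwich_blockDiagonal, rtr_square_blockDiagonal,
    Finset.mul_sum, ← Finset.sum_add_distrib]
  rfl

open MeasureTheory in
/-- A spectral sum of `x ↦ k x y * (x / y) ^ p` as an integral of harmonic-type spectral sums. -/
lemma spectralSum_eq_integral {A : Matrix n n ℂ} (hA : A.PosSemidef) {B : Matrix m m ℂ}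
    (hB : B.PosSemidef) (X : Matrix n m ℂ) {q : ℝ} (hq : q ∈ Set.Ioo (0 : ℝ) 1)
    (k : ℝ → ℝ → ℝ) :
    IntegrableOn (fun t => spectralSum (fun x y => k x y * Real.rpowIntegrand₀₁ q t (x / y))
      hA.isHermitian hB.isHermitian X) (Set.Ioi 0) ∧
    spectralSum (fun x y => k x y * (x / y) ^ q) hA.isHermitian hB.isHermitian X
      = (∫ t in Set.Ioi 0, Real.rpowIntegrand₀₁ q t 1)⁻¹ *
        ∫ t in Set.Ioi 0, spectralSum (fun x y => k x y * Real.rpowIntegrand₀₁ q t (x / y))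
          hA.isHermitian hB.isHermitian X := by
  have hint : ∀ i j, IntegrableOn (fun t => k (hA.isHermitian.eigenvalues i)
      (hB.isHermitian.eigenvalues j) * Real.rpowIntegrand₀₁ q t
        (hA.isHermitian.eigenvalues i / hB.isHermitian.eigenvalues j) *
      Complex.normSq ((star (hA.isHermitian.eigenvectorUnitary : Matrix n n ℂ) * X *
      (hB.isHermitian.eigenvectorUnitary : Matrix m m ℂ)) i j)) (Set.Ioi 0) := fun i j =>
    ((Real.integrableOn_rpowIntegrand₀₁_Ioi hq
      (div_nonneg (hA.eigenvalues_nonneg i) (hB.eigenvalues_nonneg j))).const_mul _).mul_const _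
  constructor
  · unfold spectralSum
    exact integrable_finsetSum _ fun i _ => integrable_finsetSum _ fun j _ => hint i j
  · unfold spectralSum
    rw [integral_finsetSum _ fun i _ => integrable_finsetSum _ fun j _ => hint i j,
      Finset.mul_sum]
    refine Finset.sum_congr rfl fun i _ => ?_
    rw [integral_finsetSum _ fun j _ => hint i j, Finset.mul_sum]
    refine Finset.sum_congr rfl fun j _ => ?_
    beta_reduce
    rw [integral_mul_const, integral_const_mul, Real.rpow_eq_const_mul_integral hq
      (div_nonneg (hA.eigenvalues_nonneg i) (hB.eigenvalues_nonneg j))]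
    ring

open MeasureTheory in
/-- Lieb-type pinching inequality, `0 < s < 1`. -/
lemma spectralSum_rpow_pinch_le {T Z : Matrix (n × m) (n × m) ℂ} (hT : T.PosSemidef)
    (hZ : Z.PosSemidef) (X : Matrix n n ℂ) {s : ℝ} (hs : s ∈ Set.Ioo (0 : ℝ) 1) :
    spectralSum (fun x y => x ^ s * y ^ (1 - s)) hT.isHermitian hZ.isHermitian
        (Matrix.blockDiagonal fun _ : m => X)
      ≤ ∑ e, spectralSum (fun x y => x ^ s * y ^ (1 - s)) (block_posSemidef hT e).isHermitian
          (block_posSemidef hZ e).isHermitian X := by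
  have hscal : ∀ x y : ℝ, 0 ≤ x → 0 ≤ y → x ^ s * y ^ (1 - s) = y * (x / y) ^ s := by
    intro x y hx hy
    rcases hy.eq_or_lt with rfl | hy
    · simp [Real.zero_rpow (sub_pos.2 hs.2).ne']
    · rw [Real.div_rpow hx hy.le, Real.rpow_sub hy, Real.rpow_one]
      field_simp
  have hker : ∀ t x y : ℝ, 0 < t → 0 ≤ x → 0 ≤ y →
      y * Real.rpowIntegrand₀₁ s t (x / y)
        = t ^ (s - 1) * (x * y / (t * y + x)) + 0 * x := by
    intro t x y ht hx hy
    rw [Real.rpowIntegrand₀₁_eq_pow_div hs ht.le (div_nonneg hx hy)]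
    rcases hy.eq_or_lt with rfl | hy
    · simp
    · have : 0 < t * y + x := by positivity
      field_simp
      ring
  rw [spectralSum_congr (G := fun x y => y * (x / y) ^ s) _ _ _ fun i j =>
    hscal _ _ (hT.eigenvalues_nonneg i) (hZ.eigenvalues_nonneg j),
    Finset.sum_congr rfl fun e _ => spectralSum_congr (G := fun x y => y * (x / y) ^ s) _ _ _
      fun i j =>
      hscal _ _ ((block_posSemidef hT e).eigenvalues_nonneg i)
        ((block_posSemidef hZ e).eigenvalues_nonneg j)]
  obtain ⟨hi, he⟩ := spectralSum_eq_integral hT hZ (Matrix.blockDiagonal fun _ : m => X) hs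
    (fun _ y => y)
  have hi' := fun e => spectralSum_eq_integral (block_posSemidef hT e) (block_posSemidef hZ e) X hs
    (fun _ y => y)
  rw [he, Finset.sum_congr rfl fun e _ => (hi' e).2, ← Finset.mul_sum,
    ← integral_finsetSum _ fun e _ => (hi' e).1]
  refine mul_le_mul_of_nonneg_left ?_ (inv_nonneg.2 (Real.integral_rpowIntegrand₀₁_one_pos hs).le)
  refine setIntegral_mono_on hi (integrable_finsetSum _ fun e _ => (hi' e).1)
    measurableSet_Ioi fun t ht => ?_
  have ht : 0 < t := ht
  rw [spectralSum_congr (G := fun x y => t ^ (s - 1) * (x * y / (t * y + x)) + 0 * x) _ _ _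
    fun i j => hker t _ _ ht (hT.eigenvalues_nonneg i) (hZ.eigenvalues_nonneg j),
    Finset.sum_congr rfl fun e _ => spectralSum_congr
      (G := fun x y => t ^ (s - 1) * (x * y / (t * y + x)) + 0 * x) _ _ _ fun i j =>
      hker t _ _ ht ((block_posSemidef hT e).eigenvalues_nonneg i)
        ((block_posSemidef hZ e).eigenvalues_nonneg j)]
  simp only [spectralSum_lincomb]
  simp only [zero_mul, add_zero, ← Finset.mul_sum]
  exact mul_le_mul_of_nonneg_left (spectralSum_harmonic_pinch hT hZ X ht)
    (Real.rpow_nonneg ht.le _)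

open MeasureTheory in
/-- Ando-type pinching inequality, `1 < s < 2`. -/
lemma le_spectralSum_rpow_pinch_of_lt_two {T Z : Matrix (n × m) (n × m) ℂ} (hT : T.PosSemidef)
    (hZ : Z.PosDef) (X : Matrix n n ℂ) {s : ℝ} (hs : s ∈ Set.Ioo (1 : ℝ) 2) :
    ∑ e, spectralSum (fun x y => x ^ s * y ^ (1 - s)) (block_posSemidef hT e).isHermitian
          (block_posDef hZ e).isHermitian X
      ≤ spectralSum (fun x y => x ^ s * y ^ (1 - s)) hT.isHermitian hZ.isHermitian
        (Matrix.blockDiagonal fun _ : m => X) := by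
  have hq : s - 1 ∈ Set.Ioo (0 : ℝ) 1 := ⟨by linarith [hs.1], by linarith [hs.2]⟩
  have hscal : ∀ x y : ℝ, 0 ≤ x → 0 < y → x ^ s * y ^ (1 - s) = x * (x / y) ^ (s - 1) := by
    intro x y hx hy
    rcases hx.eq_or_lt with rfl | hx
    · simp [Real.zero_rpow (show s ≠ 0 by linarith [hs.1])]
    · rw [Real.div_rpow hx.le hy.le, Real.rpow_sub hx, Real.rpow_one, ← neg_sub s 1,
        Real.rpow_neg hy.le]
      field_simp
  have hker : ∀ t x y : ℝ, 0 < t → 0 ≤ x → 0 < y →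
      x * Real.rpowIntegrand₀₁ (s - 1) t (x / y)
        = t ^ (s - 1 - 1) * x + (- (t ^ (s - 1 - 1) * t)) * (x * y / (t * y + x)) := by
    intro t x y ht hx hy
    rw [Real.rpowIntegrand₀₁_eq_pow_div hq ht.le (div_nonneg hx hy.le)]
    have : 0 < t * y + x := by positivity
    field_simp
    ring
  have hZ' := hZ.posSemidef
  rw [spectralSum_congr (G := fun x y => x * (x / y) ^ (s - 1)) _ _ _ fun i j =>
    hscal _ _ (hT.eigenvalues_nonneg i) (hZ.eigenvalues_pos j),
    Finset.sum_congr rfl fun e _ => spectralSum_congr (G := fun x y => x * (x / y) ^ (s - 1)) _ _ _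
      fun i j =>
      hscal _ _ ((block_posSemidef hT e).eigenvalues_nonneg i)
        ((block_posDef hZ e).eigenvalues_pos j)]
  obtain ⟨hi, he⟩ := spectralSum_eq_integral hT hZ.posSemidef
    (Matrix.blockDiagonal fun _ : m => X) hq (fun x _ => x)
  have hi' := fun e => spectralSum_eq_integral (block_posSemidef hT e)
    (block_posDef hZ e).posSemidef X hq (fun x _ => x)
  rw [he, Finset.sum_congr rfl fun e _ => (hi' e).2, ← Finset.mul_sum,
    ← integral_finsetSum _ fun e _ => (hi' e).1]
  refine mul_le_mul_of_nonneg_left ?_ (inv_nonneg.2 (Real.integral_rpowIntegrand₀₁_one_pos hq).le)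
  refine setIntegral_mono_on (integrable_finsetSum _ fun e _ => (hi' e).1) hi
    measurableSet_Ioi fun t ht => ?_
  have ht : 0 < t := ht
  rw [spectralSum_congr
      (G := fun x y => t ^ (s - 1 - 1) * x + (- (t ^ (s - 1 - 1) * t)) * (x * y / (t * y + x))) _ _ _
    fun i j => hker t _ _ ht (hT.eigenvalues_nonneg i) (hZ.eigenvalues_pos j),
    Finset.sum_congr rfl fun e _ => spectralSum_congr
      (G := fun x y => t ^ (s - 1 - 1) * x + (- (t ^ (s - 1 - 1) * t)) * (x * y / (t * y + x))) _ _ _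
        fun i j =>
      hker t _ _ ht ((block_posSemidef hT e).eigenvalues_nonneg i)
        ((block_posDef hZ e).eigenvalues_pos j)]
  simp only [spectralSum_lincomb, Finset.sum_add_distrib, ← Finset.mul_sum, spectralSum_left]
  rw [rtr_sandwich_blockDiagonal]
  have h1 := spectralSum_harmonic_pinch hT hZ.posSemidef X ht
  have h2 : 0 ≤ t ^ (s - 1 - 1) * t := by positivity
  have h3 := mul_le_mul_of_nonneg_left h1 h2
  linarith

lemma continuousOn_spectralSum_rpow {A : Matrix n n ℂ} (hA : A.IsHermitian) {B : Matrix m m ℂ}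
    (hB : B.PosDef) (X : Matrix n m ℂ) :
    ContinuousOn (fun s : ℝ => spectralSum (fun x y => x ^ s * y ^ (1 - s)) hA hB.isHermitian X)
      (Set.Ioi 0) := by
  unfold spectralSum
  refine continuousOn_finsetSum _ fun i _ => continuousOn_finsetSum _ fun j _ => ?_
  refine ContinuousOn.mul (ContinuousOn.mul ?_ ?_) continuousOn_const
  · exact fun s hs => (Real.continuousAt_const_rpow' (ne_of_gt hs)).continuousWithinAt
  · exact (continuous_const.rpow (by fun_prop)
      fun s => Or.inl (hB.eigenvalues_pos j).ne').continuousOn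

/-- Ando-type pinching inequality, `1 < s ≤ 2`. -/
lemma le_spectralSum_rpow_pinch {T Z : Matrix (n × m) (n × m) ℂ} (hT : T.PosSemidef)
    (hZ : Z.PosDef) (X : Matrix n n ℂ) {s : ℝ} (hs : s ∈ Set.Ioc (1 : ℝ) 2) :
    ∑ e, spectralSum (fun x y => x ^ s * y ^ (1 - s)) (block_posSemidef hT e).isHermitian
          (block_posDef hZ e).isHermitian X
      ≤ spectralSum (fun x y => x ^ s * y ^ (1 - s)) hT.isHermitian hZ.isHermitian
        (Matrix.blockDiagonal fun _ : m => X) := by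
  have hcl : s ∈ closure (Set.Ioo (1 : ℝ) 2) := by
    rw [closure_Ioo (by norm_num)]
    exact Set.Ioc_subset_Icc_self hs
  have hs0 : s ∈ Set.Ioi (0 : ℝ) := lt_trans one_pos hs.1
  have hsub : Set.Ioo (1 : ℝ) 2 ⊆ Set.Ioi 0 := fun u hu => lt_trans one_pos hu.1
  refine ContinuousWithinAt.closure_le (f := fun s : ℝ => ∑ e, spectralSum
    (fun x y => x ^ s * y ^ (1 - s)) (block_posSemidef hT e).isHermitian
          (block_posDef hZ e).isHermitian X)
    (g := fun s : ℝ => spectralSum (fun x y => x ^ s * y ^ (1 - s)) hT.isHermitian hZ.isHermitian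
        (Matrix.blockDiagonal fun _ : m => X)) hcl ?_ ?_
    fun u hu => le_spectralSum_rpow_pinch_of_lt_two hT hZ X hu
  · exact ((continuousOn_finsetSum _ fun e _ =>
      continuousOn_spectralSum_rpow _ (block_posDef hZ e) X) s hs0).mono hsub
  · exact ((continuousOn_spectralSum_rpow _ hZ _) s hs0).mono hsub

end Pinching

section PinchedPower

variable {m : Type*} [Fintype m] [DecidableEq m]

lemma spectralSum_one {A : Matrix n n ℂ} (hA : A.IsHermitian) {B : Matrix n n ℂ}
    (hB : B.IsHermitian) (f g : ℝ → ℝ) :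
    spectralSum (fun x y => f x * g y) hA hB 1 = rtr (mfun f A * mfun g B) := by
  simp [spectralSum_mul hA hB 1 f g]

lemma rtr_linear_eq_spectralSum {A : Matrix n n ℂ} (hA : A.IsHermitian) {B : Matrix n n ℂ}
    (hB : B.IsHermitian) (c d : ℝ) (f : ℝ → ℝ) :
    c * rtr (mfun f A) + d * rtr B = spectralSum (fun x y => c * f x + d * y) hA hB 1 := by
  have h := spectralSum_one hA hB f (fun _ => 1)
  rw [mfun_one hB, Matrix.mul_one] at h
  rw [spectralSum_lincomb hA hB 1 c d (fun x _ => f x) (fun _ y => y), spectralSum_right,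
    ← h]
  simp

lemma rtr_mul_mpow_eq_spectralSum {A : Matrix n n ℂ} (hA : A.IsHermitian) {B : Matrix n n ℂ}
    (hB : B.IsHermitian) (q : ℝ) :
    rtr (A * mpow B q) = spectralSum (fun x y => x * y ^ q) hA hB 1 := by
  rw [spectralSum_one hA hB (fun x => x) (fun y => y ^ q), mfun_id hA, mpow]

/-- Young's trace inequality. -/
lemma rtr_mul_mpow_le {Y W : Matrix n n ℂ} (hY : Y.PosSemidef) (hW : W.PosSemidef) {α : ℝ}
    (hα : 1 < α) :
    rtr (Y * mpow W (1 - α⁻¹)) ≤ α⁻¹ * rtr (mpow Y α) + (1 - α⁻¹) * rtr W := by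
  have h0 : 0 < α := by linarith
  have h1 : α⁻¹ < 1 := inv_lt_one_of_one_lt₀ hα
  rw [rtr_mul_mpow_eq_spectralSum hY.isHermitian hW.isHermitian, mpow,
    rtr_linear_eq_spectralSum hY.isHermitian hW.isHermitian]
  refine spectralSum_mono _ _ _ fun i j => ?_
  have hx := hY.eigenvalues_nonneg i
  have hy := hW.eigenvalues_nonneg j
  have := Real.geom_mean_le_arith_mean2_weighted (inv_pos.2 h0).le (sub_pos.2 h1).le
    (Real.rpow_nonneg hx α) hy (by ring)
  rwa [← Real.rpow_mul hx, mul_inv_cancel₀ h0.ne', Real.rpow_one] at this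

/-- Reverse form of Young's trace inequality. -/
lemma le_rtr_mul_mpow {Y W : Matrix n n ℂ} (hY : Y.PosSemidef) (hW : W.PosDef) {α : ℝ}
    (h0 : 0 < α) (h1 : α < 1) :
    α⁻¹ * rtr (mpow Y α) + (1 - α⁻¹) * rtr W ≤ rtr (Y * mpow W (1 - α⁻¹)) := by
  rw [rtr_mul_mpow_eq_spectralSum hY.isHermitian hW.isHermitian, mpow,
    rtr_linear_eq_spectralSum hY.isHermitian hW.isHermitian]
  refine spectralSum_mono _ _ _ fun i j => ?_
  have hx := hY.eigenvalues_nonneg i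
  have hy := hW.eigenvalues_pos j
  set x := hY.isHermitian.eigenvalues i
  set y := hW.isHermitian.eigenvalues j
  have := Real.geom_mean_le_arith_mean2_weighted h0.le (sub_pos.2 h1).le
    (mul_nonneg hx (Real.rpow_nonneg hy.le (1 - α⁻¹))) hy.le (by ring)
  have e : (1 - α⁻¹) * α + (1 - α) = 0 := by field_simp; ring
  rw [Real.mul_rpow hx (Real.rpow_nonneg hy.le _), ← Real.rpow_mul hy.le, mul_assoc,
    ← Real.rpow_add hy, e, Real.rpow_zero, mul_one] at this
  have h2 := mul_le_mul_of_nonneg_left this (inv_pos.2 h0).le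
  have e2 : α⁻¹ * (α * (x * y ^ (1 - α⁻¹)) + (1 - α) * y)
      = x * y ^ (1 - α⁻¹) + (α⁻¹ - 1) * y := by field_simp
  linarith

/-- The trace functional `Tr (Xᴴ T^(1/α) X)^α`. -/
def tracePow (α : ℝ) (X : Matrix n m ℂ) (T : Matrix n n ℂ) : ℝ :=
  rtr (mpow (X.conjTranspose * mpow T α⁻¹ * X) α)

lemma sandwich_posSemidef {T : Matrix n n ℂ} (hT : T.PosSemidef) (X : Matrix n m ℂ) (s : ℝ) :
    (X.conjTranspose * mpow T s * X).PosSemidef :=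
  (mpow_posSemidef hT s).conjTranspose_mul_mul_same X

lemma tracePow_nonneg {T : Matrix n n ℂ} (hT : T.PosSemidef) (α : ℝ) (X : Matrix n m ℂ) :
    0 ≤ tracePow α X T :=
  rtr_nonneg (mpow_posSemidef (sandwich_posSemidef hT X _) _)

lemma sum_rtr_block (Z : Matrix (n × m) (n × m) ℂ) : ∑ e, rtr (block Z e) = rtr Z := by
  have := rtr_mul_blockDiagonal Z (fun _ => 1)
  rw [show (Matrix.blockDiagonal fun _ : m => (1 : Matrix n n ℂ)) = 1 from
    Matrix.blockDiagonal_one] at this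
  simpa using this.symm

lemma tracePow_pinch_le {T : Matrix (n × m) (n × m) ℂ} (hT : T.PosSemidef) (X : Matrix n n ℂ)
    {α : ℝ} (hα : 1 < α) :
    tracePow α (Matrix.blockDiagonal fun _ : m => X) T ≤ ∑ e, tracePow α X (block T e) := by
  have h0 : 0 < α := by linarith
  have h1 : α⁻¹ < 1 := inv_lt_one_of_one_lt₀ hα
  set Xt : Matrix (n × m) (n × m) ℂ := Matrix.blockDiagonal fun _ : m => X with hXt
  set Y := Xt.conjTranspose * mpow T α⁻¹ * Xt with hY
  have hYp : Y.PosSemidef := sandwich_posSemidef hT Xt _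
  have hZ : (mpow Y α).PosSemidef := mpow_posSemidef hYp α
  have hG : rtr (Y * mpow (mpow Y α) (1 - α⁻¹)) = rtr (mpow Y α) := by
    conv_lhs => enter [1, 1]; rw [← mfun_id hYp.isHermitian]
    rw [mpow, mpow, mfun_mfun hYp.isHermitian, mfun_mul_mfun hYp.isHermitian]
    congr 1
    refine mfun_congr_nonneg hYp fun x hx => ?_
    have e : α * (1 - α⁻¹) = α - 1 := by field_simp
    rw [← Real.rpow_mul hx, e]
    rcases hx.eq_or_lt with rfl | hx
    · simp [Real.zero_rpow h0.ne']
    · rw [mul_comm, ← Real.rpow_add_one hx.ne', sub_add_cancel]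
  have h2 := spectralSum_rpow_pinch_le hT hZ X ⟨inv_pos.2 h0, h1⟩
  rw [spectralSum_mul _ _ _ (fun x => x ^ α⁻¹) (fun y => y ^ (1 - α⁻¹))] at h2
  have h3 : rtr (mpow Y α) ≤ ∑ e, (α⁻¹ * tracePow α X (block T e)
      + (1 - α⁻¹) * rtr (block (mpow Y α) e)) := by
    rw [← hG]
    refine h2.trans (Finset.sum_le_sum fun e _ => ?_)
    rw [spectralSum_mul _ _ _ (fun x => x ^ α⁻¹) (fun y => y ^ (1 - α⁻¹))]
    exact rtr_mul_mpow_le (sandwich_posSemidef (block_posSemidef hT e) X _)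
      (block_posSemidef hZ e) hα
  rw [Finset.sum_add_distrib, ← Finset.mul_sum, ← Finset.mul_sum, sum_rtr_block] at h3
  refine le_of_mul_le_mul_left ?_ (inv_pos.2 h0)
  show α⁻¹ * rtr (mpow Y α) ≤ _
  linarith

lemma le_tracePow_pinch {T : Matrix (n × m) (n × m) ℂ} (hT : T.PosSemidef) (X : Matrix n n ℂ)
    {α : ℝ} (hα : α ∈ Set.Ico (2⁻¹ : ℝ) 1) :
    ∑ e, tracePow α X (block T e) ≤ tracePow α (Matrix.blockDiagonal fun _ : m => X) T := by
  have h0 : 0 < α := lt_of_lt_of_le (by norm_num) hα.1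
  have h1 : 1 < α⁻¹ := (one_lt_inv₀ h0).2 hα.2
  have h2 : α⁻¹ ≤ 2 := by
    rw [inv_le_comm₀ h0 (by norm_num)]
    exact hα.1
  set Xt : Matrix (n × m) (n × m) ℂ := Matrix.blockDiagonal fun _ : m => X with hXt
  set Y := Xt.conjTranspose * mpow T α⁻¹ * Xt with hY
  have hYp : Y.PosSemidef := sandwich_posSemidef hT Xt _
  have key : ∀ δ : ℝ, 0 < δ → α⁻¹ * ∑ e, tracePow α X (block T e)
      ≤ tracePow α Xt T + (α⁻¹ - 1) * rtr (mfun (fun x => (x + δ) ^ α) Y) := by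
    intro δ hδ
    set Z := mfun (fun x => (x + δ) ^ α) Y with hZdef
    have hZ : Z.PosDef := mfun_posDef hYp.isHermitian fun i =>
      Real.rpow_pos_of_pos (add_pos_of_nonneg_of_pos (hYp.eigenvalues_nonneg i) hδ) _
    have hG : rtr (Y * mpow Z (1 - α⁻¹)) ≤ tracePow α Xt T := by
      conv_lhs => enter [1, 1]; rw [← mfun_id hYp.isHermitian]
      rw [mpow, hZdef, mfun_mfun hYp.isHermitian, mfun_mul_mfun hYp.isHermitian, tracePow, mpow,
        ← hY, rtr_mfun hYp.isHermitian, rtr_mfun hYp.isHermitian]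
      refine Finset.sum_le_sum fun i _ => ?_
      have hx := hYp.eigenvalues_nonneg i
      have e : α * (1 - α⁻¹) = α - 1 := by field_simp
      set x := hYp.isHermitian.eigenvalues i
      rw [← Real.rpow_mul (by positivity), e]
      rcases hx.eq_or_lt with hx | hx
      · simp [← hx, Real.zero_rpow h0.ne']
      · calc x * (x + δ) ^ (α - 1) ≤ x * x ^ (α - 1) := by
              refine mul_le_mul_of_nonneg_left ?_ hx.le
              exact Real.rpow_le_rpow_of_nonpos hx (by linarith) (by linarith [hα.2])
          _ = x ^ α := by rw [mul_comm, ← Real.rpow_add_one hx.ne', sub_add_cancel]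
    have h3 := le_spectralSum_rpow_pinch hT hZ X ⟨h1, h2⟩
    rw [spectralSum_mul _ _ _ (fun x => x ^ α⁻¹) (fun y => y ^ (1 - α⁻¹))] at h3
    have h4 : ∑ e, (α⁻¹ * tracePow α X (block T e) + (1 - α⁻¹) * rtr (block Z e))
        ≤ tracePow α Xt T := by
      refine le_trans (Finset.sum_le_sum fun e _ => ?_) (h3.trans hG)
      rw [spectralSum_mul _ _ _ (fun x => x ^ α⁻¹) (fun y => y ^ (1 - α⁻¹))]
      exact le_rtr_mul_mpow (sandwich_posSemidef (block_posSemidef hT e) X _)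
        (block_posDef hZ e) h0 hα.2
    rw [Finset.sum_add_distrib, ← Finset.mul_sum, ← Finset.mul_sum, sum_rtr_block] at h4
    linarith
  have hlim : Filter.Tendsto (fun δ : ℝ => tracePow α Xt T
      + (α⁻¹ - 1) * rtr (mfun (fun x => (x + δ) ^ α) Y)) (nhdsWithin 0 (Set.Ioi 0))
      (nhds (tracePow α Xt T + (α⁻¹ - 1) * tracePow α Xt T)) := by
    have hc : Continuous fun δ : ℝ => tracePow α Xt T
        + (α⁻¹ - 1) * rtr (mfun (fun x => (x + δ) ^ α) Y) := by
      simp only [rtr_mfun hYp.isHermitian]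
      refine continuous_const.add (continuous_const.mul (continuous_finsetSum _ fun i _ => ?_))
      exact (continuous_const.add continuous_id).rpow_const fun _ => Or.inr h0.le
    have := (hc.tendsto 0).mono_left (nhdsWithin_le_nhds (s := Set.Ioi 0))
    simpa [show tracePow α Xt T = rtr (mfun (fun x => x ^ α) Y) from rfl] using this
  have h5 := ge_of_tendsto hlim (Filter.eventually_of_mem self_mem_nhdsWithin key)
  refine le_of_mul_le_mul_left ?_ (inv_pos.2 h0)
  linarith

lemma tracePow_smul {T : Matrix n n ℂ} (hT : T.PosSemidef) {α : ℝ} (hα : 0 < α)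
    (X : Matrix n m ℂ) {c : ℝ} (hc : 0 ≤ c) : tracePow α X ((c : ℂ) • T) = c * tracePow α X T := by
  rw [tracePow, mpow_smul hT hc, Matrix.mul_smul, Matrix.smul_mul,
    mpow_smul (sandwich_posSemidef hT X _) (Real.rpow_nonneg hc _), rtr_smul,
    ← Real.rpow_mul hc, inv_mul_cancel₀ hα.ne', Real.rpow_one, tracePow]

end PinchedPower

section Amplification

variable {m : Type*} [Fintype m] [DecidableEq m]

/-- The Choi matrix of a linear map. -/
def choi (N : Matrix a a ℂ →ₗ[ℂ] Matrix b b ℂ) : Matrix (b × a) (b × a) ℂ :=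
  Matrix.of fun p q => N (Matrix.single p.2 q.2 1) p.1 q.1

lemma tensorId_apply (N : Matrix a a ℂ →ₗ[ℂ] Matrix b b ℂ) (ρ : Matrix (a × r) (a × r) ℂ)
    (p q : b × r) :
    tensorId N r ρ p q = ∑ x, ∑ y, ρ (x, p.2) (y, q.2) * choi N (p.1, x) (q.1, y) := by
  show N (Matrix.of fun x y => ρ (x, p.2) (y, q.2)) p.1 q.1 = _
  rw [Matrix.matrix_eq_sum_single (Matrix.of fun x y => ρ (x, p.2) (y, q.2))]
  simp only [map_sum, Matrix.sum_apply]
  refine Finset.sum_congr rfl fun x _ => Finset.sum_congr rfl fun y _ => ?_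
  have h : Matrix.single x y ((Matrix.of fun x y => ρ (x, p.2) (y, q.2)) x y)
      = ρ (x, p.2) (y, q.2) • (Matrix.single x y (1 : ℂ)) := by
    rw [Matrix.smul_single]
    simp
  rw [h, map_smul]
  rfl

lemma choi_posSemidef {N : Matrix a a ℂ →ₗ[ℂ] Matrix b b ℂ} (hN : IsChannel N) :
    (choi N).PosSemidef := by
  let e := Fintype.equivFin a
  let γ : a × Fin (Fintype.card a) → ℂ := fun p => if e p.1 = p.2 then 1 else 0
  have h := (hN.2 _ _ (Matrix.posSemidef_vecMulVec_self_star γ)).submatrix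
    fun p : b × a => (p.1, e p.2)
  convert h using 1
  ext p q
  show _ = N (Matrix.of fun x y => Matrix.vecMulVec γ (star γ) (x, e p.2) (y, e q.2)) p.1 q.1
  have : (Matrix.of fun x y => Matrix.vecMulVec γ (star γ) (x, e p.2) (y, e q.2))
      = Matrix.single p.2 q.2 1 := by
    ext x y
    simp only [Matrix.of_apply, Matrix.vecMulVec_apply, γ, Pi.star_apply, Matrix.single_apply,
      EmbeddingLike.apply_eq_iff_eq, eq_comm (a := x), eq_comm (a := y)]
    split_ifs <;> simp_all
  rw [this]
  rfl

lemma ptraceA_tensorId {N : Matrix a a ℂ →ₗ[ℂ] Matrix b b ℂ} (hN : IsChannel N)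
    (ρ : Matrix (a × r) (a × r) ℂ) : ptraceA (tensorId N r ρ) = ptraceA ρ := by
  ext i j
  exact hN.1 (Matrix.of fun x y => ρ (x, i) (y, j))

lemma tensorId_randomizing (ρ : Matrix (a × r) (a × r) ℂ) :
    tensorId (randomizing a b) r ρ
      = (((Fintype.card b : ℝ)⁻¹ : ℝ) : ℂ) • ((1 : Matrix b b ℂ) ⊗ₖ ptraceA ρ) := by
  ext p q
  show Matrix.trace (Matrix.of fun x y => ρ (x, p.2) (y, q.2)) *
    ((Fintype.card b : ℂ)⁻¹ * (1 : Matrix b b ℂ) p.1 q.1) = _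
  rw [Matrix.smul_apply, Matrix.kroneckerMap_apply, smul_eq_mul]
  have : Matrix.trace (Matrix.of fun x y => ρ (x, p.2) (y, q.2)) = ptraceA ρ p.2 q.2 := rfl
  rw [this]
  push_cast
  ring

/-- Amplification of a factor `M` of an input state `M * Mᴴ`: it factors the output of every
channel through the Choi matrix. -/
def amplify (b : Type*) [DecidableEq b] (M : Matrix (a × r) m ℂ) :
    Matrix (b × r) ((b × a) × m) ℂ :=
  Matrix.of fun p q => if p.1 = q.1.1 then M (q.1.2, p.2) q.2 else 0

lemma amplify_mul_conjTranspose (M : Matrix (a × r) m ℂ) :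
    amplify b M * (amplify b M).conjTranspose
      = (1 : Matrix b b ℂ) ⊗ₖ ptraceA (M * M.conjTranspose) := by
  ext ⟨i, k⟩ ⟨j, l⟩
  simp only [Matrix.mul_apply, Matrix.conjTranspose_apply, amplify, Matrix.of_apply, ptraceA,
    Matrix.kroneckerMap_apply, Fintype.sum_prod_type, Matrix.one_apply]
  rw [Finset.sum_eq_single i (by intro x _ hx; simp [hx.symm]) (by simp)]
  by_cases h : i = j
  · simp [h]
  · simp [h, Ne.symm h]

lemma tensorId_eq_amplify (N : Matrix a a ℂ →ₗ[ℂ] Matrix b b ℂ) (M : Matrix (a × r) m ℂ) :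
    tensorId N r (M * M.conjTranspose)
      = amplify b M * (Matrix.blockDiagonal fun _ : m => choi N)
        * (amplify b M).conjTranspose := by
  ext ⟨i, k⟩ ⟨j, l⟩
  rw [tensorId_apply]
  simp only [Matrix.mul_apply, Matrix.conjTranspose_apply, amplify, Matrix.of_apply,
    Fintype.sum_prod_type, Matrix.blockDiagonal_apply]
  rw [Finset.sum_eq_single j (by intro x _ hx; simp [hx.symm]) (by simp), Finset.sum_comm]
  refine Finset.sum_congr rfl fun y _ => ?_
  simp only [if_true, Finset.sum_mul]
  rw [Finset.sum_comm]
  refine Finset.sum_congr rfl fun e _ => ?_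
  rw [Finset.sum_eq_single i (by intro x _ hx; simp [hx.symm]) (by simp)]
  refine Finset.sum_congr rfl fun x _ => ?_
  rw [Finset.sum_eq_single e (by intro z _ hz; simp [hz]) (by simp)]
  simp only [if_true]
  ring

/-- The reduced operator of a column of `M` on the input system, up to transposition. -/
def columnReduced (M : Matrix (a × r) m ℂ) (e : m) : Matrix a a ℂ :=
  Matrix.of fun x y => ∑ k, star (M (x, k) e) * M (y, k) e

lemma columnReduced_posSemidef (M : Matrix (a × r) m ℂ) (e : m) :
    (columnReduced M e).PosSemidef := by
  have h := Matrix.posSemidef_conjTranspose_mul_self (Matrix.of fun k x => M (x, k) e)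
  exact h

lemma sum_trace_columnReduced (M : Matrix (a × r) m ℂ) :
    ∑ e, Matrix.trace (columnReduced M e) = Matrix.trace (M * M.conjTranspose) := by
  simp only [Matrix.trace, Matrix.diag, columnReduced, Matrix.of_apply, Matrix.mul_apply,
    Matrix.conjTranspose_apply, Fintype.sum_prod_type]
  rw [Finset.sum_comm]
  refine Finset.sum_congr rfl fun x _ => ?_
  rw [Finset.sum_comm]
  refine Finset.sum_congr rfl fun k _ => Finset.sum_congr rfl fun e _ => mul_comm _ _

lemma block_amplify (M : Matrix (a × r) m ℂ) (e : m) :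
    block ((amplify b M).conjTranspose * amplify b M) e
      = (1 : Matrix b b ℂ) ⊗ₖ columnReduced M e := by
  ext ⟨i, x⟩ ⟨j, y⟩
  simp only [block, Matrix.submatrix_apply, Matrix.mul_apply, Matrix.conjTranspose_apply, amplify,
    Matrix.of_apply, Matrix.kroneckerMap_apply, Fintype.sum_prod_type, Matrix.one_apply,
    columnReduced]
  rw [Finset.sum_eq_single i (by intro x _ hx; simp [hx]) (by simp)]
  by_cases h : i = j
  · simp [h]
  · simp [h]

lemma sandTr_factor {κ : Type*} [Fintype κ] [DecidableEq κ] {α : ℝ} (hα : 0 < α)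
    (L : Matrix n κ ℂ) (X : Matrix κ m ℂ) :
    sandTr α (L * (X * X.conjTranspose) * L.conjTranspose) (L * L.conjTranspose)
      = tracePow α X (L.conjTranspose * L) := by
  have h1 : (L * L.conjTranspose).PosSemidef := Matrix.posSemidef_self_mul_conjTranspose L
  have h2 : (L.conjTranspose * L).PosSemidef := Matrix.posSemidef_conjTranspose_mul_self L
  set q := (1 - α) / (2 * α) with hq
  set S := mpow (L * L.conjTranspose) q with hS
  have hSh : S.conjTranspose = S := mfun_isHermitian _ _
  have e1 : S * (L * (X * X.conjTranspose) * L.conjTranspose) * S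
      = (S * L * X) * (S * L * X).conjTranspose := by
    simp only [Matrix.conjTranspose_mul, hSh, Matrix.mul_assoc]
  have e2 : L.conjTranspose * (S * S) * L = mpow (L.conjTranspose * L) α⁻¹ := by
    rw [hS, mpow, mfun_mul_mfun h1.isHermitian, Matrix.mul_assoc,
      mfun_mul_intertwine h1.isHermitian h2.isHermitian (Matrix.mul_assoc _ _ _),
      ← Matrix.mul_assoc]
    conv_lhs => enter [1]; rw [← mfun_id h2.isHermitian]
    rw [mfun_mul_mfun h2.isHermitian]
    refine mfun_congr_nonneg h2 fun x hx => ?_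
    rcases hx.eq_or_lt with rfl | hx
    · simp [Real.zero_rpow (inv_ne_zero hα.ne')]
    · rw [← Real.rpow_add hx, mul_comm, ← Real.rpow_add_one hx.ne', hq]
      congr 1
      field_simp
      ring
  have e3 : (S * L * X).conjTranspose * (S * L * X)
      = X.conjTranspose * mpow (L.conjTranspose * L) α⁻¹ * X := by
    rw [← e2]
    simp only [Matrix.conjTranspose_mul, hSh, Matrix.mul_assoc]
  rw [sandTr, ← hq, ← hS, e1, rtr_mpow_mul_conjTranspose _ hα.ne', e3, tracePow]

lemma mpow_conjTranspose (A : Matrix n n ℂ) (s : ℝ) : (mpow A s).conjTranspose = mpow A s :=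
  mfun_isHermitian _ A

lemma mpow_half_mul_self {A : Matrix n n ℂ} (hA : A.PosSemidef) :
    mpow A 2⁻¹ * mpow A 2⁻¹ = A := by
  rw [mpow, mfun_mul_mfun hA.isHermitian]
  refine (mfun_congr_nonneg hA fun x hx => ?_).trans (mfun_id hA.isHermitian)
  rw [← Real.rpow_add' hx (by norm_num)]
  norm_num

/-- The square root of the Choi matrix. -/
def choiSqrt (N : Matrix a a ℂ →ₗ[ℂ] Matrix b b ℂ) : Matrix (b × a) (b × a) ℂ :=
  mpow (choi N) 2⁻¹

lemma choiSqrt_mul_conjTranspose {N : Matrix a a ℂ →ₗ[ℂ] Matrix b b ℂ} (hN : IsChannel N) :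
    choiSqrt N * (choiSqrt N).conjTranspose = choi N := by
  rw [choiSqrt, mpow_conjTranspose, mpow_half_mul_self (choi_posSemidef hN)]

/-- The trace functional of the channel output relative to the reduced input. -/
def outputTr (α : ℝ) (N : Matrix a a ℂ →ₗ[ℂ] Matrix b b ℂ) (ρ : Matrix (a × r) (a × r) ℂ) : ℝ :=
  sandTr α (tensorId N r ρ) ((1 : Matrix b b ℂ) ⊗ₖ ptraceA ρ)

lemma outputTr_eq {N : Matrix a a ℂ →ₗ[ℂ] Matrix b b ℂ} (hN : IsChannel N) {α : ℝ} (hα : 0 < α)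
    (M : Matrix (a × r) m ℂ) :
    outputTr α N (M * M.conjTranspose)
      = tracePow α (Matrix.blockDiagonal fun _ : m => choiSqrt N)
        ((amplify b M).conjTranspose * amplify b M) := by
  rw [outputTr, tensorId_eq_amplify, ← amplify_mul_conjTranspose, ← sandTr_factor hα,
    Matrix.blockDiagonal_conjTranspose, ← Matrix.blockDiagonal_mul, choiSqrt_mul_conjTranspose hN]

lemma outputTr_column {N : Matrix a a ℂ →ₗ[ℂ] Matrix b b ℂ} (hN : IsChannel N) {α : ℝ}
    (hα : 0 < α) (M : Matrix (a × r) Unit ℂ) :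
    outputTr α N (M * M.conjTranspose)
      = tracePow α (choiSqrt N) ((1 : Matrix b b ℂ) ⊗ₖ columnReduced M ()) := by
  let e : b × a ≃ (b × a) × Unit := (Equiv.prodPUnit _).symm
  let L := (amplify b M).submatrix id e
  have hL : L.conjTranspose * L = (1 : Matrix b b ℂ) ⊗ₖ columnReduced M () := by
    rw [← block_amplify]
    rfl
  have hJ : (Matrix.blockDiagonal fun _ : Unit => choi N).submatrix e e = choi N := by
    ext i j
    simp [Matrix.blockDiagonal_apply, e]
  have h1 : L * L.conjTranspose = (1 : Matrix b b ℂ) ⊗ₖ ptraceA (M * M.conjTranspose) := by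
    rw [← amplify_mul_conjTranspose, Matrix.conjTranspose_submatrix, Matrix.submatrix_mul_equiv,
      Matrix.submatrix_id_id]
  have h2 : L * choi N * L.conjTranspose = tensorId N r (M * M.conjTranspose) := by
    conv_lhs => rw [← hJ]
    rw [tensorId_eq_amplify, Matrix.conjTranspose_submatrix, Matrix.submatrix_mul_equiv,
      Matrix.submatrix_mul_equiv, Matrix.submatrix_id_id]
  rw [outputTr, ← h1, ← h2, ← hL, ← sandTr_factor hα, choiSqrt_mul_conjTranspose hN]

lemma outputTr_submatrix {N : Matrix a a ℂ →ₗ[ℂ] Matrix b b ℂ} (hN : IsChannel N) {α : ℝ}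
    (hα : 0 < α) (M : Matrix (a × r) m ℂ) (e : c ≃ r) :
    outputTr α N ((M * M.conjTranspose).submatrix (Prod.map id e) (Prod.map id e))
      = outputTr α N (M * M.conjTranspose) := by
  have h : (M * M.conjTranspose).submatrix (Prod.map id e) (Prod.map id e)
      = M.submatrix (Prod.map id e) id * (M.submatrix (Prod.map id e) id).conjTranspose := by
    rw [Matrix.conjTranspose_submatrix]
    exact (Matrix.submatrix_mul_equiv M M.conjTranspose _ (Equiv.refl m) _).symm
  rw [h, outputTr_eq hN hα, outputTr_eq hN hα]
  congr 1
  have h2 : amplify b (M.submatrix (Prod.map id e) id)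
      = (amplify b M).submatrix ((Equiv.refl b).prodCongr e) id := rfl
  rw [h2, Matrix.conjTranspose_submatrix, Matrix.submatrix_mul_equiv, Matrix.submatrix_id_id]

end Amplification

section ChannelEntropy

lemma one_kronecker_posSemidef {τ : Matrix a a ℂ} (hτ : τ.PosSemidef) :
    ((1 : Matrix b b ℂ) ⊗ₖ τ).PosSemidef :=
  Matrix.PosSemidef.one.kronecker hτ

lemma exists_le_of_le_weighted_sum {ι : Type*} [Fintype ι] {c g : ι → ℝ} (hc : ∀ i, 0 ≤ c i)
    (hsum : ∑ i, c i = 1) {q : ℝ} (h : q ≤ ∑ i, c i * g i) : ∃ i, q ≤ g i := by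
  by_contra! hlt
  have h1 : ∑ i, c i * q = q := by rw [← Finset.sum_mul, hsum, one_mul]
  have h2 : ∀ i ∈ Finset.univ, c i * g i ≤ c i * q := fun i _ =>
    mul_le_mul_of_nonneg_left (hlt i).le (hc i)
  have h3 : ∑ i, c i * g i = ∑ i, c i * q :=
    le_antisymm (Finset.sum_le_sum h2) (by rw [h1]; exact h)
  have h4 := (Finset.sum_eq_sum_iff_of_le h2).1 h3
  have h5 : ∀ i, c i = 0 := fun i => by
    by_contra hne
    exact (hlt i).ne (mul_left_cancel₀ hne (h4 i (Finset.mem_univ i)))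
  simp [h5] at hsum

lemma isState_maxMixed [Nonempty a] : IsState (maxMixed a) := by
  refine ⟨Matrix.PosSemidef.one.smul (by positivity), ?_⟩
  rw [maxMixed, Matrix.trace_smul, Matrix.trace_one, smul_eq_mul, inv_mul_cancel₀]
  exact_mod_cast Fintype.card_ne_zero

lemma rtr_one_kronecker (τ : Matrix a a ℂ) :
    rtr ((1 : Matrix b b ℂ) ⊗ₖ τ) = Fintype.card b * rtr τ := by
  rw [rtr, Matrix.trace_kronecker, Matrix.trace_one, rtr]
  simp

/-- Every positive semidefinite `σ` is `Tr σ` times a state, on which `tracePow` factors. -/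
lemma exists_state_tracePow_eq [Nonempty a] {α : ℝ} (hα : 0 < α)
    (X : Matrix (b × a) (b × a) ℂ) {σ : Matrix a a ℂ} (hσ : σ.PosSemidef) :
    ∃ τ : Matrix a a ℂ, IsState τ ∧ tracePow α X ((1 : Matrix b b ℂ) ⊗ₖ σ)
      = rtr σ * tracePow α X ((1 : Matrix b b ℂ) ⊗ₖ τ) := by
  have htr : Matrix.trace σ = (rtr σ : ℂ) := by
    have := hσ.trace_nonneg
    rw [Complex.nonneg_iff] at this
    exact Complex.ext rfl this.2.symm
  have key : ∀ τ : Matrix a a ℂ, IsState τ → σ = (rtr σ : ℂ) • τ →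
      tracePow α X ((1 : Matrix b b ℂ) ⊗ₖ σ)
        = rtr σ * tracePow α X ((1 : Matrix b b ℂ) ⊗ₖ τ) := by
    intro τ hτ h
    rw [← tracePow_smul (one_kronecker_posSemidef hτ.1) hα X (rtr_nonneg hσ),
      ← Matrix.kronecker_smul, ← h]
  by_cases h0 : rtr σ = 0
  · refine ⟨maxMixed a, isState_maxMixed, key _ isState_maxMixed ?_⟩
    rw [h0, Complex.ofReal_zero, zero_smul]
    exact hσ.trace_eq_zero_iff.1 (by rw [htr, h0, Complex.ofReal_zero])
  · have hc : (rtr σ : ℂ) ≠ 0 := by exact_mod_cast h0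
    have hstate : IsState ((rtr σ : ℂ)⁻¹ • σ) := by
      refine ⟨hσ.smul ?_, ?_⟩
      · rw [← Complex.ofReal_inv]
        exact_mod_cast inv_nonneg.2 (rtr_nonneg hσ)
      · rw [Matrix.trace_smul, htr, smul_eq_mul, inv_mul_cancel₀ hc]
    exact ⟨_, hstate, key _ hstate (by rw [smul_smul, mul_inv_cancel₀ hc, one_smul])⟩

lemma mpow_half_factor {ρ : Matrix n n ℂ} (hρ : ρ.PosSemidef) :
    mpow ρ 2⁻¹ * (mpow ρ 2⁻¹).conjTranspose = ρ := by
  rw [mpow_conjTranspose, mpow_half_mul_self hρ]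

lemma exists_state_outputTr_le [Nonempty a] {N : Matrix a a ℂ →ₗ[ℂ] Matrix b b ℂ}
    (hN : IsChannel N) {α : ℝ} (hα : α ∈ Set.Ico (2⁻¹ : ℝ) 1 ∪ Set.Ioi 1)
    {ρ : Matrix (a × r) (a × r) ℂ} (hρ : IsState ρ) :
    ∃ τ : Matrix a a ℂ, IsState τ ∧ (α - 1)⁻¹ * outputTr α N ρ
      ≤ (α - 1)⁻¹ * tracePow α (choiSqrt N) ((1 : Matrix b b ℂ) ⊗ₖ τ) := by
  have h0 : 0 < α := by
    rcases hα with h | h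
    · exact lt_of_lt_of_le (by norm_num) h.1
    · exact zero_lt_one.trans h
  set M := mpow ρ 2⁻¹ with hM
  have hMρ : M * M.conjTranspose = ρ := mpow_half_factor hρ.1
  have hT : ((amplify b M).conjTranspose * amplify b M).PosSemidef :=
    Matrix.posSemidef_conjTranspose_mul_self _
  choose τ hτ hτe using fun e => exists_state_tracePow_eq h0 (choiSqrt N)
    (columnReduced_posSemidef M e)
  have hsum : ∑ e, rtr (columnReduced M e) = 1 := by
    have := sum_trace_columnReduced M
    rw [hMρ, hρ.2] at this
    simpa [rtr] using congrArg Complex.re this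
  have hQ := outputTr_eq hN h0 M
  rw [hMρ] at hQ
  have hle : (α - 1)⁻¹ * outputTr α N ρ ≤ ∑ e, rtr (columnReduced M e) *
      ((α - 1)⁻¹ * tracePow α (choiSqrt N) ((1 : Matrix b b ℂ) ⊗ₖ τ e)) := by
    have e1 : ∑ e, rtr (columnReduced M e) *
        ((α - 1)⁻¹ * tracePow α (choiSqrt N) ((1 : Matrix b b ℂ) ⊗ₖ τ e))
        = (α - 1)⁻¹ * ∑ e, tracePow α (choiSqrt N)
          (block ((amplify b M).conjTranspose * amplify b M) e) := by
      rw [Finset.mul_sum]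
      refine Finset.sum_congr rfl fun e _ => ?_
      rw [block_amplify, hτe, mul_left_comm]
    rw [e1, hQ]
    rcases hα with h | h
    · exact mul_le_mul_of_nonpos_left (le_tracePow_pinch hT _ h)
        (inv_nonpos.2 (by linarith [h.2]))
    · have h : 1 < α := h
      exact mul_le_mul_of_nonneg_left (tracePow_pinch_le hT _ h) (inv_nonneg.2 (by linarith))
  obtain ⟨e, he⟩ := exists_le_of_le_weighted_sum
    (fun e => rtr_nonneg (columnReduced_posSemidef M e)) hsum hle
  exact ⟨τ e, hτ e, he⟩

lemma exists_pureState_outputTr_eq {N : Matrix a a ℂ →ₗ[ℂ] Matrix b b ℂ} (hN : IsChannel N)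
    {α : ℝ} (hα : 0 < α) {τ : Matrix a a ℂ} (hτ : IsState τ) :
    ∃ ψ : Matrix (a × a) (a × a) ℂ, IsPureState ψ ∧
      outputTr α N ψ = tracePow α (choiSqrt N) ((1 : Matrix b b ℂ) ⊗ₖ τ) := by
  let M : Matrix (a × a) Unit ℂ := Matrix.of fun p _ => mpow τ 2⁻¹ p.2 p.1
  have hM : columnReduced M () = τ := by
    have h := mpow_half_mul_self hτ.1
    nth_rw 1 [← mpow_conjTranspose] at h
    exact h
  have htr : Matrix.trace (M * M.conjTranspose) = 1 := by
    rw [← sum_trace_columnReduced]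
    simp [hM, hτ.2]
  refine ⟨M * M.conjTranspose,
    ⟨⟨Matrix.posSemidef_self_mul_conjTranspose M, htr⟩, ?_⟩, ?_⟩
  · refine le_antisymm ?_ (Nat.one_le_iff_ne_zero.2 fun h => ?_)
    · rw [Matrix.rank_self_mul_conjTranspose]
      exact M.rank_le_card_width
    · have h2 := LinearMap.range_eq_bot.1 (Submodule.finrank_eq_zero.1 h)
      have h3 : M * M.conjTranspose = 0 := Matrix.toLin'.map_eq_zero_iff.1 h2
      simp [h3] at htr
  · rw [outputTr_column hN hα, hM]

lemma eigenvalues_le_rtr {A : Matrix n n ℂ} (hA : A.PosSemidef) (i : n) :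
    hA.isHermitian.eigenvalues i ≤ rtr A := by
  have h := rtr_mfun hA.isHermitian fun x => x
  rw [mfun_id hA.isHermitian] at h
  rw [h]
  exact Finset.single_le_sum (f := fun i => hA.isHermitian.eigenvalues i)
    (fun j _ => hA.eigenvalues_nonneg j) (Finset.mem_univ i)

lemma tracePow_le {m : Type*} [Fintype m] [DecidableEq m] {T : Matrix n n ℂ} (hT : T.PosSemidef)
    {α : ℝ} (hα : 0 < α) (X : Matrix n m ℂ) :
    tracePow α X T
      ≤ Fintype.card m * ((rtr T) ^ α⁻¹ * rtr (X.conjTranspose * X)) ^ α := by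
  have hY := sandwich_posSemidef hT X α⁻¹
  have h1 : rtr (X.conjTranspose * mpow T α⁻¹ * X)
      ≤ (rtr T) ^ α⁻¹ * rtr (X.conjTranspose * X) := by
    have e1 := spectralSum_mul hT.isHermitian (Matrix.isHermitian_one (n := m) (α := ℂ)) X
      (fun x => x ^ α⁻¹) (fun _ => 1)
    have e2 := spectralSum_mul hT.isHermitian (Matrix.isHermitian_one (n := m) (α := ℂ)) X
      (fun _ => 1) (fun _ => 1)
    have e3 := spectralSum_lincomb hT.isHermitian (Matrix.isHermitian_one (n := m) (α := ℂ)) X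
      ((rtr T) ^ α⁻¹) 0 (fun _ _ => 1 * 1) (fun _ _ => 0)
    rw [mfun_one Matrix.isHermitian_one, Matrix.mul_one] at e1 e2
    rw [mfun_one hT.isHermitian, Matrix.mul_one] at e2
    rw [mpow, ← e1, ← e2]
    simp only [zero_mul, add_zero] at e3
    rw [← e3]
    refine spectralSum_mono _ _ _ fun i j => ?_
    have := Real.rpow_le_rpow (hT.eigenvalues_nonneg i) (eigenvalues_le_rtr hT i)
      (inv_pos.2 hα).le
    simpa using this
  rw [tracePow, mpow, rtr_mfun hY.isHermitian]
  refine (Finset.sum_le_card_nsmul _ _ _ fun i _ => ?_).trans_eq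
    (by rw [Finset.card_univ, nsmul_eq_mul])
  exact Real.rpow_le_rpow (hY.eigenvalues_nonneg i) ((eigenvalues_le_rtr hY i).trans h1) hα.le

lemma exists_bound_tracePow {α : ℝ} (hα : α ∈ Set.Ico (2⁻¹ : ℝ) 1 ∪ Set.Ioi 1)
    (X : Matrix (b × a) (b × a) ℂ) :
    ∃ C : ℝ, ∀ τ : Matrix a a ℂ, IsState τ →
      (α - 1)⁻¹ * tracePow α X ((1 : Matrix b b ℂ) ⊗ₖ τ) ≤ C := by
  rcases hα with h | h
  · refine ⟨0, fun τ hτ => mul_nonpos_of_nonpos_of_nonneg (inv_nonpos.2 (by linarith [h.2])) ?_⟩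
    exact tracePow_nonneg (one_kronecker_posSemidef hτ.1) _ _
  · have h : 1 < α := h
    refine ⟨(α - 1)⁻¹ * (Fintype.card (b × a) * ((Fintype.card b : ℝ) ^ α⁻¹ *
      rtr (X.conjTranspose * X)) ^ α), fun τ hτ =>
        mul_le_mul_of_nonneg_left ?_ (inv_nonneg.2 (by linarith))⟩
    have := tracePow_le (one_kronecker_posSemidef (b := b) hτ.1) (zero_lt_one.trans h) X
    rwa [rtr_one_kronecker, rtr, hτ.2, Complex.one_re, mul_one] at this

lemma sandTr_smul_right {α : ℝ} (hα : 0 < α) {ρ σ : Matrix n n ℂ} (hρ : ρ.PosSemidef)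
    (hσ : σ.PosSemidef) {c : ℝ} (hc : 0 < c) :
    sandTr α ρ ((c : ℂ) • σ) = c ^ (1 - α) * sandTr α ρ σ := by
  set q := (1 - α) / (2 * α) with hq
  have h1 : (mpow σ q * ρ * mpow σ q).PosSemidef := by
    have := hρ.mul_mul_conjTranspose_same (mpow σ q)
    rwa [mpow_conjTranspose] at this
  have e : ((c ^ q) * (c ^ q)) ^ α = c ^ (1 - α) := by
    rw [← Real.rpow_add hc, ← Real.rpow_mul hc.le, hq]
    congr 1
    field_simp
    ring
  rw [sandTr, ← hq, mpow_smul hσ hc.le, Matrix.smul_mul, Matrix.smul_mul, Matrix.mul_smul,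
    smul_smul, ← Complex.ofReal_mul, mpow_smul h1 (by positivity), rtr_smul, e, sandTr]

lemma one_kronecker_ptraceA_posSemidef {ρ : Matrix (a × r) (a × r) ℂ} (hρ : ρ.PosSemidef) :
    ((1 : Matrix b b ℂ) ⊗ₖ ptraceA ρ).PosSemidef := by
  have h := amplify_mul_conjTranspose (b := b) (mpow ρ 2⁻¹)
  rw [mpow_half_factor hρ] at h
  rw [← h]
  exact Matrix.posSemidef_self_mul_conjTranspose _

lemma sandTsallis_randomizing [Nonempty b] {N : Matrix a a ℂ →ₗ[ℂ] Matrix b b ℂ}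
    (hN : IsChannel N) {α : ℝ} (hα : 0 < α) {k : ℕ} {ρ : Matrix (a × Fin k) (a × Fin k) ℂ}
    (hρ : ρ.PosSemidef) :
    sandTsallis α (tensorId N (Fin k) ρ) (tensorId (randomizing a b) (Fin k) ρ)
      = (α - 1)⁻¹ * ((Fintype.card b : ℝ) ^ (α - 1) * outputTr α N ρ - 1) := by
  have hd : (0 : ℝ) < Fintype.card b := by exact_mod_cast Fintype.card_pos
  rw [sandTsallis, tensorId_randomizing, sandTr_smul_right hα (hN.2 k ρ hρ)
    (one_kronecker_ptraceA_posSemidef hρ) (inv_pos.2 hd), Real.inv_rpow hd.le,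
    ← Real.rpow_neg hd.le, neg_sub, outputTr]

lemma condTsallisSandDown_tensorId {N : Matrix a a ℂ →ₗ[ℂ] Matrix b b ℂ}
    (hN : IsChannel N) (α : ℝ) (ρ : Matrix (a × r) (a × r) ℂ) :
    condTsallisSandDown α (tensorId N r ρ) = -((α - 1)⁻¹ * (outputTr α N ρ - 1)) := by
  rw [condTsallisSandDown, sandTsallis, ptraceA_tensorId hN, outputTr]

/-- A state with reference `a` can be moved to the reference `Fin (card a)`. -/
lemma exists_state_fin_outputTr_eq {N : Matrix a a ℂ →ₗ[ℂ] Matrix b b ℂ}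
    (hN : IsChannel N) {α : ℝ} (hα : 0 < α) {ρ : Matrix (a × a) (a × a) ℂ} (hρ : IsState ρ) :
    ∃ σ : Matrix (a × Fin (Fintype.card a)) (a × Fin (Fintype.card a)) ℂ, IsState σ ∧
      outputTr α N σ = outputTr α N ρ := by
  let e := (Fintype.equivFin a).symm
  have hM := mpow_half_factor hρ.1
  refine ⟨ρ.submatrix (Prod.map id e) (Prod.map id e), ⟨hρ.1.submatrix _, ?_⟩, ?_⟩
  · rw [← hρ.2]
    exact Fintype.sum_equiv ((Equiv.refl a).prodCongr e) _ _ fun _ => rfl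
  · have h := outputTr_submatrix hN hα (mpow ρ 2⁻¹) e
    rwa [hM] at h

end ChannelEntropy

theorem chTsallisEnt_eq_iInf_condTsallisSandDown {A B : Type} [Fintype A] [DecidableEq A] [Nonempty A]
    [Fintype B] [DecidableEq B] [Nonempty B]
    (α : ℝ) (hα : α ∈ Set.Ico (2⁻¹ : ℝ) 1 ∪ Set.Ioi 1)
    (N : Matrix A A ℂ →ₗ[ℂ] Matrix B B ℂ) (hN : IsChannel N) :
    chTsallisEnt α N = ⨅ ψ : {ψ : Matrix (A × A) (A × A) ℂ // IsPureState ψ},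
      condTsallisSandDown α (tensorId N A ψ.1) := by
  have h0 : 0 < α := by
    rcases hα with h | h
    · exact lt_of_lt_of_le (by norm_num) h.1
    · exact zero_lt_one.trans h
  have h1 : α - 1 ≠ 0 := by
    rcases hα with h | h
    · exact (sub_neg.2 h.2).ne
    · exact (sub_pos.2 h).ne'
  have hd : (0 : ℝ) < Fintype.card B := by exact_mod_cast Fintype.card_pos
  set w := (Fintype.card B : ℝ) ^ (1 - α) with hw
  have hw0 : 0 < w := Real.rpow_pos_of_pos hd _
  have hww : w * (Fintype.card B : ℝ) ^ (α - 1) = 1 := by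
    rw [hw, ← Real.rpow_add hd]
    simp
  set D : (Σ k : ℕ, {ρ : Matrix (A × Fin k) (A × Fin k) ℂ // IsState ρ}) → ℝ := fun p =>
    sandTsallis α (tensorId N (Fin p.1) p.2.1) (tensorId (randomizing A B) (Fin p.1) p.2.1) with hD
  have hDp : ∀ p, w * D p = (α - 1)⁻¹ * (outputTr α N p.2.1 - w) := by
    intro p
    rw [hD]
    simp only
    rw [sandTsallis_randomizing hN h0 p.2.2.1]
    linear_combination (α - 1)⁻¹ * outputTr α N p.2.1 * hww
  have hK : (w - 1) / (1 - α) = (α - 1)⁻¹ * (1 - w) := by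
    rw [div_eq_inv_mul, ← neg_sub α 1, inv_neg]
    ring
  obtain ⟨C, hC⟩ := exists_bound_tracePow hα (choiSqrt N)
  have hbdd : BddAbove (Set.range D) := by
    refine ⟨w⁻¹ * (C - (α - 1)⁻¹ * w), ?_⟩
    rintro _ ⟨p, rfl⟩
    obtain ⟨τ, hτ, hle⟩ := exists_state_outputTr_le hN hα p.2.2
    rw [le_inv_mul_iff₀ hw0, hDp, mul_sub]
    linarith [hC τ hτ]
  have hne : Nonempty {ψ : Matrix (A × A) (A × A) ℂ // IsPureState ψ} := by
    obtain ⟨ψ, hψ, -⟩ := exists_pureState_outputTr_eq hN h0 (isState_maxMixed (a := A))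
    exact ⟨ψ, hψ⟩
  have hle : ∀ ψ : {ψ : Matrix (A × A) (A × A) ℂ // IsPureState ψ},
      chTsallisEnt α N ≤ condTsallisSandDown α (tensorId N A ψ.1) := by
    intro ψ
    obtain ⟨σ, hσ, he⟩ := exists_state_fin_outputTr_eq hN h0 ψ.2.1
    have h2 := mul_le_mul_of_nonneg_left (le_ciSup hbdd ⟨_, σ, hσ⟩) hw0.le
    rw [hDp, he] at h2
    rw [condTsallisSandDown_tensorId hN]
    show (w - 1) / (1 - α) - w * iSup D ≤ _
    rw [hK]
    linarith
  refine le_antisymm (le_ciInf hle) ?_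
  show _ ≤ (w - 1) / (1 - α) - w * iSup D
  have hne' : Nonempty (Σ k : ℕ, {ρ : Matrix (A × Fin k) (A × Fin k) ℂ // IsState ρ}) := by
    obtain ⟨ψ⟩ := hne
    obtain ⟨σ, hσ, -⟩ := exists_state_fin_outputTr_eq hN h0 ψ.2.1
    exact ⟨⟨_, σ, hσ⟩⟩
  rw [le_sub_comm, ← le_inv_mul_iff₀ hw0]
  refine ciSup_le fun p => ?_
  obtain ⟨τ, hτ, hp⟩ := exists_state_outputTr_le hN hα p.2.2
  obtain ⟨ψ, hψ, he⟩ := exists_pureState_outputTr_eq hN h0 hτ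
  have hinf := ciInf_le (f := fun ψ : {ψ : Matrix (A × A) (A × A) ℂ // IsPureState ψ} =>
    condTsallisSandDown α (tensorId N A ψ.1)) ⟨_, Set.forall_mem_range.2 hle⟩ ⟨ψ, hψ⟩
  simp only [condTsallisSandDown_tensorId hN α ψ, he] at hinf
  rw [le_inv_mul_iff₀ hw0, hDp, hK]
  linarith

end QIT
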